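/- arXiv:2302.13250 — 4 statements merged into one kernel-verified Lean document; each statement's English description precedes it below -/
import Mathlib

section
/- Let σ be a partition of the set of all primes. A finite group G is σ-nilpotent if and only if every subgroup of G is σ-subnormal in G. -/
open Subgroup
open scoped Pointwise

section Defs

variable {ι : Type*}

/-- `σ` is a partition of the set of all primes. -/
structure IsPrimePartition (σ : ι → Set ℕ) : Prop where
  prime_of_mem : ∀ i p, p ∈ σ i → p.Prime
  existsUnique_mem : ∀ p : ℕ, p.Prime → ∃! i, p ∈ σ i

/-- every prime dividing `n` lies in the block `σ i`. -/
def IsSigmaNumber (σ : ι → Set ℕ) (i : ι) (n : ℕ) : Prop :=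
  ∀ p : ℕ, p.Prime → p ∣ n → p ∈ σ i

/-- `G` is a `σ i`-group. -/
def IsSigmaIGroup (σ : ι → Set ℕ) (i : ι) (G : Type*) [Group G] : Prop :=
  IsSigmaNumber σ i (Nat.card G)

/-- `G` is σ-primary: it is a `σ i`-group for some `i`. -/
def IsSigmaPrimary (σ : ι → Set ℕ) (G : Type*) [Group G] : Prop :=
  ∃ i, IsSigmaIGroup σ i G

/-- `G` is σ-nilpotent: `G` is the internal direct product of normal
σ-primary subgroups (one `σ i`-subgroup for each block). -/
def IsSigmaNilpotent (σ : ι → Set ℕ) (G : Type*) [Group G] : Prop :=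
  ∃ H : ι → Subgroup G, (∀ i, (H i).Normal) ∧ (∀ i, IsSigmaIGroup σ i ↥(H i)) ∧
    iSupIndep H ∧ iSup H = ⊤

/-- One step in a σ-subnormal chain: `A ≤ B` and either `A` is normal in `B` or
`B/(A_B)` (quotient by the normal core of `A` in `B`) is σ-primary. -/
def SigmaSubnormalStep (σ : ι → Set ℕ) {G : Type*} [Group G] (A B : Subgroup G) : Prop :=
  A ≤ B ∧ (((A.subgroupOf B).Normal) ∨
    IsSigmaPrimary σ (↥B ⧸ (A.subgroupOf B).normalCore))

/-- `A` is σ-subnormal in `G`. -/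
def IsSigmaSubnormal (σ : ι → Set ℕ) {G : Type*} [Group G] (A : Subgroup G) : Prop :=
  ∃ n, ∃ C : Fin (n + 1) → Subgroup G, C 0 = A ∧ C (Fin.last n) = ⊤ ∧
    ∀ k : Fin n, SigmaSubnormalStep σ (C k.castSucc) (C k.succ)

/-- `A` is subnormal in `G`. -/
def IsSubnormalSub {G : Type*} [Group G] (A : Subgroup G) : Prop :=
  ∃ n, ∃ C : Fin (n + 1) → Subgroup G, C 0 = A ∧ C (Fin.last n) = ⊤ ∧
    ∀ k : Fin n, C k.castSucc ≤ C k.succ ∧ ((C k.castSucc).subgroupOf (C k.succ)).Normal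

/-- `M` is a modular subgroup of `G`: a modular element of the subgroup lattice. -/
def IsModularSubgroup {G : Type*} [Group G] (M : Subgroup G) : Prop :=
  (∀ X Z : Subgroup G, X ≤ Z → X ⊔ (M ⊓ Z) = (X ⊔ M) ⊓ Z) ∧
  (∀ Y Z : Subgroup G, M ≤ Z → M ⊔ (Y ⊓ Z) = (M ⊔ Y) ⊓ Z)

/-- `A` is submodular in `G`: there is a chain from `A` to `G` with each
term modular in the next. -/
def IsSubmodular {G : Type*} [Group G] (A : Subgroup G) : Prop :=
  ∃ n, ∃ C : Fin (n + 1) → Subgroup G, C 0 = A ∧ C (Fin.last n) = ⊤ ∧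
    ∀ k : Fin n, C k.castSucc ≤ C k.succ ∧
      IsModularSubgroup ((C k.castSucc).subgroupOf (C k.succ))

/-- `H` is a Hall `σ i`-subgroup of `G`. -/
def IsHallSigmaI (σ : ι → Set ℕ) (i : ι) {G : Type*} [Group G] (H : Subgroup G) : Prop :=
  IsSigmaNumber σ i (Nat.card H) ∧ ∀ p : ℕ, p.Prime → p ∣ H.index → p ∉ σ i

/-- `G` is σ-full: it has a Hall `σ i`-subgroup for every `σ i ∈ σ(G)`. -/
def IsSigmaFull (σ : ι → Set ℕ) (G : Type*) [Group G] : Prop :=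
  ∀ i, (∃ p : ℕ, p.Prime ∧ p ∈ σ i ∧ p ∣ Nat.card G) →
    ∃ H : Subgroup G, IsHallSigmaI σ i H

/-- Two subgroups permute. -/
def Permutes {G : Type*} [Group G] (A B : Subgroup G) : Prop :=
  (A : Set G) * (B : Set G) = (B : Set G) * (A : Set G)

/-- `A` is σ-permutable in `G`: it permutes with every Hall `σ i`-subgroup of `G`
(hence with all their conjugates). -/
def IsSigmaPermutable (σ : ι → Set ℕ) {G : Type*} [Group G] (A : Subgroup G) : Prop :=
  ∀ i, ∀ H : Subgroup G, IsHallSigmaI σ i H → Permutes A H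

/-- `A` is quasinormal (permutable) in `G`. -/
def IsQuasinormal {G : Type*} [Group G] (A : Subgroup G) : Prop :=
  ∀ B : Subgroup G, Permutes A B

/-- `A` is σ-quasinormal in `G`: modular and σ-subnormal. -/
def IsSigmaQuasinormal (σ : ι → Set ℕ) {G : Type*} [Group G] (A : Subgroup G) : Prop :=
  IsModularSubgroup A ∧ IsSigmaSubnormal σ A

/-- σ-permutability is a transitive relation on `G`. -/
def IsPSigmaTGroup (σ : ι → Set ℕ) (G : Type*) [Group G] : Prop :=
  ∀ K H : Subgroup G, H ≤ K → IsSigmaPermutable σ (H.subgroupOf K) →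
    IsSigmaPermutable σ K → IsSigmaPermutable σ H

/-- `H/K` is a chief factor of `G`. -/
def IsChiefFactor (G : Type*) [Group G] (K H : Subgroup G) : Prop :=
  K.Normal ∧ H.Normal ∧ K < H ∧
    ∀ N : Subgroup G, N.Normal → K ≤ N → N ≤ H → N = K ∨ N = H

/-- `G` is σ-soluble: every chief factor of `G` is σ-primary. -/
def IsSigmaSoluble (σ : ι → Set ℕ) (G : Type*) [Group G] : Prop :=
  ∀ K H : Subgroup G, ∀ hc : IsChiefFactor G K H,
    letI := hc.1; IsSigmaPrimary σ (↥H ⧸ K.subgroupOf H)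

/-- The σ-nilpotent residual `G^{𝔑_σ}` of `G`. -/
def sigmaNilpotentResidual (σ : ι → Set ℕ) (G : Type*) [Group G] : Subgroup G :=
  sInf {N : Subgroup G | ∃ h : N.Normal, letI := h; IsSigmaNilpotent σ (G ⧸ N)}

/-- The σ-soluble residual `G^{𝔖_σ}` of `G`. -/
def sigmaSolubleResidual (σ : ι → Set ℕ) (G : Type*) [Group G] : Subgroup G :=
  sInf {N : Subgroup G | ∃ h : N.Normal, letI := h; IsSigmaSoluble σ (G ⧸ N)}

/-- `G` is a σ-SC-group: every chief factor of `G` below `G^{𝔑_σ}` is simple. -/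
def IsSigmaSCGroup (σ : ι → Set ℕ) (G : Type*) [Group G] : Prop :=
  ∀ K H : Subgroup G, ∀ hc : IsChiefFactor G K H, H ≤ sigmaNilpotentResidual σ G →
    letI := hc.1; IsSimpleGroup (↥H ⧸ K.subgroupOf H)

/-- `G` is σ-supersoluble: every chief factor of `G` below `G^{𝔑_σ}` is cyclic. -/
def IsSigmaSupersoluble (σ : ι → Set ℕ) (G : Type*) [Group G] : Prop :=
  ∀ K H : Subgroup G, ∀ hc : IsChiefFactor G K H, H ≤ sigmaNilpotentResidual σ G →
    letI := hc.1; IsCyclic (↥H ⧸ K.subgroupOf H)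

/-- The σ-supersoluble residual `G^{𝔘_σ}` of `G`. -/
def sigmaSupersolubleResidual (σ : ι → Set ℕ) (G : Type*) [Group G] : Subgroup G :=
  sInf {N : Subgroup G | ∃ h : N.Normal, letI := h; IsSigmaSupersoluble σ (G ⧸ N)}

/-- The soluble radical `G_𝔖`: the largest soluble normal subgroup of `G`. -/
def solubleRadical (G : Type*) [Group G] : Subgroup G :=
  sSup {N : Subgroup G | N.Normal ∧ IsSolvable ↥N}

/-- `O_{σ i}(G)`: the largest normal `σ i`-subgroup of `G`. -/
def sigmaCore (σ : ι → Set ℕ) (i : ι) (G : Type*) [Group G] : Subgroup G :=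
  sSup {N : Subgroup G | N.Normal ∧ IsSigmaIGroup σ i ↥N}

/-- `O^{σ i}(G)`: the smallest normal subgroup of `G` with `σ i`-quotient. -/
def sigmaIResidual (σ : ι → Set ℕ) (i : ι) (G : Type*) [Group G] : Subgroup G :=
  sInf {N : Subgroup G | ∃ h : N.Normal, letI := h; IsSigmaIGroup σ i (G ⧸ N)}

end Defs


/-- `n` is a `π`-number. -/
def PiNum (π : Set ℕ) (n : ℕ) : Prop := ∀ p : ℕ, p.Prime → p ∣ n → p ∈ π

theorem PiNum.of_dvd {π : Set ℕ} {m n : ℕ} (h : PiNum π n) (d : m ∣ n) : PiNum π m :=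
  fun p hp hd => h p hp (hd.trans d)

theorem PiNum.mul {π : Set ℕ} {m n : ℕ} (h : PiNum π m) (h' : PiNum π n) : PiNum π (m * n) :=
  fun p hp hd => (hp.dvd_mul.1 hd).elim (h p hp) (h' p hp)

theorem PiNum.coprime {π ρ : Set ℕ} {m n : ℕ} (h : PiNum π m) (h' : PiNum ρ n)
    (hd : Disjoint π ρ) : Nat.Coprime m n := by
  apply Nat.coprime_of_dvd
  intro p hp h1 h2
  exact Set.disjoint_left.1 hd (h p hp h1) (h' p hp h2)

/-- Existence of the largest normal `π`-subgroup. -/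
theorem exists_core (π : Set ℕ) (K : Type*) [Group K] [Finite K] :
    ∃ M : Subgroup K, M.Normal ∧ PiNum π (Nat.card M) ∧
      ∀ S : Subgroup K, S.Normal → PiNum π (Nat.card S) → S ≤ M := by
  obtain ⟨M, hM⟩ := (Set.toFinite {S : Subgroup K | S.Normal ∧ PiNum π (Nat.card S)}).exists_maximal
    ⟨⊥, inferInstance, fun p hp hd => by
      rw [Subgroup.card_bot] at hd; exact absurd (Nat.dvd_one.1 hd) hp.one_lt.ne'⟩
  obtain ⟨⟨hn, hp⟩, hmax⟩ := hM
  refine ⟨M, hn, hp, fun S hS hSp => ?_⟩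
  have : M ⊔ S ≤ M := by
    apply hmax _ le_sup_left
    refine ⟨inferInstance, ?_⟩
    rw [← Subgroup.card_mul_index (M.subgroupOf (M ⊔ S))]
    refine PiNum.mul (hp.of_dvd ?_) (hSp.of_dvd ?_)
    · exact Subgroup.card_comap_dvd_of_injective _ _ (Subgroup.subtype_injective _)
    · change M.relIndex (M ⊔ S) ∣ _
      rw [Subgroup.relIndex_sup_left]
      exact Subgroup.relIndex_dvd_card _ _
  exact le_sup_right.trans this

/-- A `π`-subgroup normal in a normal subgroup lies in a normal `π`-subgroup. -/
theorem core_of_normal {π : Set ℕ} {D : Type*} [Group D] [Finite D] (K R : Subgroup D)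
    (hK : K.Normal) (hRK : R ≤ K) (hn : ∀ k ∈ K, ∀ r ∈ R, k * r * k⁻¹ ∈ R)
    (hR : PiNum π (Nat.card R)) :
    ∃ M : Subgroup D, M.Normal ∧ PiNum π (Nat.card M) ∧ R ≤ M := by
  obtain ⟨M, hM, hMp, hmax⟩ := exists_core π K
  have : M.Characteristic := by
    rw [Subgroup.characteristic_iff_map_le]
    intro φ
    apply hmax
    · exact hM.map _ φ.surjective
    · exact hMp.of_dvd (Subgroup.card_map_dvd _ _)
  refine ⟨M.map K.subtype, inferInstance, hMp.of_dvd (Subgroup.card_map_dvd _ _), ?_⟩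
  have h1 : R.subgroupOf K ≤ M := by
    apply hmax
    · constructor
      intro r hr k
      exact hn k k.2 r hr
    · exact hR.of_dvd (Subgroup.card_comap_dvd_of_injective _ _ (Subgroup.subtype_injective _))
  intro r hr
  exact ⟨⟨r, hRK hr⟩, h1 hr, rfl⟩

theorem core_trivial {π : Set ℕ} {D : Type*} [Group D] [Finite D]
    (hD : ∀ M : Subgroup D, M.Normal → PiNum π (Nat.card M) → M = ⊥)
    (K R : Subgroup D) (hK : K.Normal) (hi : PiNum π K.index)
    (hn : ∀ k ∈ K, ∀ r ∈ R, k * r * k⁻¹ ∈ R) (hR : PiNum π (Nat.card R)) : R = ⊥ := by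
  have key : ∀ K R : Subgroup D, K.Normal → R ≤ K → (∀ k ∈ K, ∀ r ∈ R, k * r * k⁻¹ ∈ R) →
      PiNum π (Nat.card R) → R = ⊥ := by
    intro K R h1 h2 h3 h4
    obtain ⟨M, hM, hMp, hRM⟩ := core_of_normal K R h1 h2 h3 h4
    rw [hD M hM hMp] at hRM
    exact le_bot_iff.1 hRM
  have hRK : R ⊓ K = ⊥ := by
    apply key K _ hK inf_le_right
    · intro k hk r hr
      exact ⟨hn k hk r hr.1, hK.conj_mem r hr.2 k⟩
    · exact hR.of_dvd (Subgroup.card_dvd_of_le inf_le_left)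
  have hcomm : ∀ k ∈ K, ∀ r ∈ R, k * r = r * k := by
    intro k hk r hr
    have : k * r * k⁻¹ * r⁻¹ ∈ R ⊓ K := by
      refine ⟨R.mul_mem (hn k hk r hr) (R.inv_mem hr), ?_⟩
      have := K.mul_mem hk (hK.conj_mem _ (K.inv_mem hk) r)
      simpa [mul_assoc] using this
    rw [hRK, Subgroup.mem_bot] at this
    have h2 : k * r * k⁻¹ = r := by
      rw [mul_inv_eq_one] at this; exact this
    rw [mul_inv_eq_iff_eq_mul] at h2
    exact h2
  let N : Subgroup D := Subgroup.centralizer (K : Set D)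
  have hN : N.Normal := inferInstance
  have hRN : R ≤ N := by
    intro r hr
    rw [Subgroup.mem_centralizer_iff]
    intro k hk
    exact hcomm k hk r hr
  have hNc : ∀ x ∈ N, ∀ k ∈ K, k * x = x * k := fun x hx k hk =>
    Subgroup.mem_centralizer_iff.1 hx k hk
  let Z : Subgroup N := K.subgroupOf N
  have hZc : PiNum πᶜ (Nat.card Z) := by
    intro p hp hd hpπ
    have : Fact p.Prime := ⟨hp⟩
    obtain ⟨z, hz⟩ := exists_prime_orderOf_dvd_card' p hd
    have hzK : ((z : N) : D) ∈ K := z.2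
    have hzN : ((z : N) : D) ∈ N := (z : N).2
    have hord : orderOf ((z : N) : D) = p := by
      rw [Subgroup.orderOf_coe, Subgroup.orderOf_coe, hz]
    have : Subgroup.zpowers ((z : N) : D) = ⊥ := by
      apply key K _ hK ((Subgroup.zpowers_le).2 hzK)
      · intro k hk r hr
        have hrN : r ∈ N := (Subgroup.zpowers_le.2 hzN) hr
        rw [hNc r hrN k hk]
        simpa using hr
      · rw [Nat.card_zpowers, hord]
        intro q hq hqd
        rwa [(Nat.prime_dvd_prime_iff_eq hq hp).1 hqd]
    rw [Subgroup.zpowers_eq_bot] at this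
    rw [this, orderOf_one] at hord
    exact hp.one_lt.ne hord
  have hZi : PiNum π Z.index :=
    hi.of_dvd (Subgroup.relIndex_dvd_index_of_normal K N)
  obtain ⟨T, hT⟩ := Subgroup.exists_right_complement'_of_coprime
    (PiNum.coprime hZc hZi disjoint_compl_left)
  have hTp : PiNum π (Nat.card T) := by
    rw [← hT.symm.index_eq_card]; exact hZi
  have hTb : T.map N.subtype = ⊥ := by
    apply key N _ hN (Subgroup.map_subtype_le T)
    · rintro n hn _ ⟨t, ht, rfl⟩
      have hn' : (⟨n, hn⟩ : N) ∈ Z ⊔ T := by rw [hT.sup_eq_top]; trivial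
      rw [Subgroup.mem_sup_of_normal_left] at hn'
      obtain ⟨z, hz, s, hs, e⟩ := hn'
      refine ⟨s * t * s⁻¹, T.mul_mem (T.mul_mem hs ht) (T.inv_mem hs), ?_⟩
      have e' : n = (z : D) * (s : D) := by
        have := congrArg Subtype.val e; simpa using this.symm
      have hc := hNc (s * t * s⁻¹ : N) (Subtype.property _) z hz
      subst e'
      simp only [Subgroup.coe_subtype, Subgroup.coe_mul, Subgroup.coe_inv] at hc ⊢
      rw [eq_comm]
      calc (z : D) * s * t * ((z : D) * (s : D))⁻¹ = z * (s * t * (s : D)⁻¹) * (z : D)⁻¹ := by group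
        _ = _ := by rw [hc]; group
    · exact hTp.of_dvd (Subgroup.card_map_dvd _ _)
  have hTb' : T = ⊥ := (Subgroup.map_eq_bot_iff_of_injective _ N.subtype_injective).1 hTb
  have hZt : Z = ⊤ := by
    have := hT.sup_eq_top
    rwa [hTb', sup_bot_eq] at this
  have hNK : N ≤ K := Subgroup.subgroupOf_eq_top.1 hZt
  rw [← hRK, eq_comm, inf_eq_left]
  exact hRN.trans hNK

theorem core_of_index {π : Set ℕ} {D : Type*} [Group D] [Finite D]
    (K R : Subgroup D) (hK : K.Normal) (hi : PiNum π K.index)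
    (hn : ∀ k ∈ K, ∀ r ∈ R, k * r * k⁻¹ ∈ R) (hR : PiNum π (Nat.card R)) :
    ∃ M : Subgroup D, M.Normal ∧ PiNum π (Nat.card M) ∧ R ≤ M := by
  obtain ⟨Q, hQ, hQp, hmax⟩ := exists_core π D
  refine ⟨Q, hQ, hQp, ?_⟩
  have hs : Function.Surjective (QuotientGroup.mk' Q) := QuotientGroup.mk'_surjective Q
  have := core_trivial (π := π) (D := D ⧸ Q) (K := K.map (QuotientGroup.mk' Q))
    (R := R.map (QuotientGroup.mk' Q)) ?_ (hK.map _ hs) (hi.of_dvd (Subgroup.index_map_dvd _ hs))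
    ?_ (hR.of_dvd (Subgroup.card_map_dvd _ _))
  · rw [Subgroup.map_eq_bot_iff, QuotientGroup.ker_mk'] at this
    exact this
  · intro M hM hMp
    have h1 : M.comap (QuotientGroup.mk' Q) ≤ Q := by
      apply hmax _ (hM.comap _)
      set L := M.comap (QuotientGroup.mk' Q) with hL
      rw [← Subgroup.card_mul_index (Q.subgroupOf L)]
      refine PiNum.mul (hQp.of_dvd
        (Subgroup.card_comap_dvd_of_injective _ _ (Subgroup.subtype_injective _)))
        (hMp.of_dvd ?_)
      have h2 := Subgroup.relIndex_ker (QuotientGroup.mk' Q) (K := L)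
      rw [QuotientGroup.ker_mk'] at h2
      change Q.relIndex L ∣ _
      rw [h2, hL, Subgroup.map_comap_eq_self_of_surjective hs]
    rw [eq_bot_iff]
    intro x hx
    obtain ⟨d, rfl⟩ := hs x
    have := h1 (show d ∈ M.comap _ from hx)
    rw [Subgroup.mem_bot]
    exact (QuotientGroup.eq_one_iff d).2 this
  · rintro _ ⟨k, hk, rfl⟩ _ ⟨r, hr, rfl⟩
    exact ⟨k * r * k⁻¹, hn k hk r hr, by simp⟩

theorem core_step {ι : Type*} {σ : ι → Set ℕ} (hσ : IsPrimePartition σ) (i : ι)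
    {D : Type*} [Group D] [Finite D] (C R : Subgroup D) (hRC : R ≤ C)
    (hn : ∀ k ∈ C, ∀ r ∈ R, k * r * k⁻¹ ∈ R) (hR : PiNum (σ i) (Nat.card R))
    (h : C.Normal ∨ IsSigmaPrimary σ (D ⧸ C.normalCore)) :
    ∃ M : Subgroup D, M.Normal ∧ PiNum (σ i) (Nat.card M) ∧ R ≤ M := by
  rcases h with h | ⟨j, hj⟩
  · exact core_of_normal C R h hRC hn hR
  have hj' : PiNum (σ j) C.normalCore.index := hj
  have hle : C.normalCore ≤ C := C.normalCore_le
  by_cases hij : j = i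
  · subst hij
    exact core_of_index C.normalCore R inferInstance hj' (fun k hk => hn k (hle hk)) hR
  · have hdis : Disjoint (σ i) (σ j) := by
      rw [Set.disjoint_left]
      intro p hpi hpj
      exact hij ((hσ.existsUnique_mem p (hσ.prime_of_mem i p hpi)).unique hpj hpi)
    refine core_of_normal C.normalCore R inferInstance ?_ (fun k hk => hn k (hle hk)) hR
    rw [← Subgroup.relIndex_eq_one]
    exact Nat.Coprime.eq_one_of_dvd
      ((PiNum.coprime hR hj' hdis).symm.coprime_dvd_left
        (Subgroup.relIndex_dvd_index_of_normal _ _) : Nat.Coprime _ (Nat.card R))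
      (Subgroup.relIndex_dvd_card _ _)

theorem core_of_chain {ι : Type*} {σ : ι → Set ℕ} (hσ : IsPrimePartition σ) (i : ι)
    {G : Type*} [Group G] [Finite G] (A : Subgroup G) (hA : PiNum (σ i) (Nat.card A))
    (h : IsSigmaSubnormal σ A) :
    ∃ M : Subgroup G, M.Normal ∧ PiNum (σ i) (Nat.card M) ∧ A ≤ M := by
  obtain ⟨n, C, h0, hl, hs⟩ := h
  have key : ∀ k : Fin (n + 1), ∃ R : Subgroup G, R ≤ C k ∧
      (∀ x ∈ C k, ∀ r ∈ R, x * r * x⁻¹ ∈ R) ∧ PiNum (σ i) (Nat.card R) ∧ A ≤ R := by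
    intro k
    induction k using Fin.induction with
    | zero =>
      refine ⟨A, h0.ge, ?_, hA, le_rfl⟩
      rw [h0]
      intro k hk r hr
      exact A.mul_mem (A.mul_mem hk hr) (A.inv_mem hk)
    | succ k ih =>
      obtain ⟨R, hRC, hn, hR, hAR⟩ := ih
      obtain ⟨hle, hst⟩ := hs k
      obtain ⟨M, hM, hMp, hRM⟩ := core_step hσ i ((C k.castSucc).subgroupOf (C k.succ))
        (R.subgroupOf (C k.succ)) (fun x hx => hRC hx) (fun x hx r hr => hn x hx r hr)
        (hR.of_dvd (Subgroup.card_comap_dvd_of_injective _ _ (Subgroup.subtype_injective _))) hst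
      refine ⟨M.map (C k.succ).subtype, Subgroup.map_subtype_le M, ?_,
        hMp.of_dvd (Subgroup.card_map_dvd _ _), ?_⟩
      · rintro x hx _ ⟨m, hm, rfl⟩
        exact ⟨_, hM.conj_mem m hm ⟨x, hx⟩, rfl⟩
      · intro a ha
        have : a ∈ C k.succ := hle (hRC (hAR ha))
        exact ⟨⟨a, this⟩, hRM (hAR ha), rfl⟩
  obtain ⟨R, -, hn, hR, hAR⟩ := key (Fin.last n)
  rw [hl] at hn
  exact ⟨R, ⟨fun r hr k => hn k trivial r hr⟩, hR, hAR⟩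

theorem nilpotent_of_all {ι : Type*} {σ : ι → Set ℕ} (hσ : IsPrimePartition σ)
    {G : Type*} [Group G] [Finite G] (h : ∀ A : Subgroup G, IsSigmaSubnormal σ A) :
    IsSigmaNilpotent σ G := by
  choose H hH hHp hmax using fun i => exists_core (σ i) G
  refine ⟨H, hH, hHp, ?_, ?_⟩
  · intro i
    obtain ⟨M, hM, hMp, hMmax⟩ := exists_core (σ i)ᶜ G
    refine Disjoint.mono_right (c := M) ?_ ?_
    · refine iSup₂_le fun j hj => hMmax _ (hH j) fun p hp hd hpi => ?_
      exact hj ((hσ.existsUnique_mem p hp).unique (hHp j p hp hd) hpi)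
    · rw [disjoint_iff]
      exact Subgroup.inf_eq_bot_of_coprime (PiNum.coprime (hHp i) hMp disjoint_compl_right)
  · rw [← Subgroup.index_eq_one]
    by_contra hne
    obtain ⟨p, hp, hd⟩ := Nat.exists_prime_and_dvd hne
    have : Fact p.Prime := ⟨hp⟩
    obtain ⟨i, hi, -⟩ := hσ.existsUnique_mem p hp
    let P : Sylow p G := default
    have hP : PiNum (σ i) (Nat.card (P : Subgroup G)) := by
      intro q hq hqd
      obtain ⟨n, hn⟩ := IsPGroup.iff_card.1 P.isPGroup'
      rw [hn] at hqd
      rwa [(Nat.prime_dvd_prime_iff_eq hq hp).1 (hq.dvd_of_dvd_pow hqd)]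
    obtain ⟨M, hM, hMp, hPM⟩ := core_of_chain hσ i (P : Subgroup G) hP (h _)
    have : (P : Subgroup G) ≤ iSup H := hPM.trans ((hmax i M hM hMp).trans (le_iSup H i))
    exact P.not_dvd_index (hd.trans (Subgroup.index_dvd_of_le this))

theorem sigmaSubnormal_of_step {ι : Type*} {σ : ι → Set ℕ} {G : Type*} [Group G]
    {A B : Subgroup G} (h : SigmaSubnormalStep σ A B) (hB : IsSigmaSubnormal σ B) :
    IsSigmaSubnormal σ A := by
  obtain ⟨n, C, h0, hl, hs⟩ := hB
  refine ⟨n + 1, Fin.cons A C, rfl, ?_, ?_⟩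
  · rw [← Fin.succ_last, Fin.cons_succ, hl]
  · intro k
    refine Fin.cases ?_ (fun k => ?_) k
    · rw [Fin.castSucc_zero, Fin.cons_zero, Fin.cons_succ, h0]
      exact h
    · rw [← Fin.succ_castSucc, Fin.cons_succ, Fin.cons_succ]
      exact hs k

theorem step_of_factor {ι : Type*} {σ : ι → Set ℕ} {G : Type*} [Group G] [Finite G]
    (i : ι) (N K A : Subgroup G) (hN : N.Normal) (hK : K.Normal) (hd : Disjoint N K)
    (hs : N ⊔ K = ⊤) (hNp : PiNum (σ i) (Nat.card N)) : SigmaSubnormalStep σ A (A ⊔ N) := by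
  refine ⟨le_sup_left, Or.inr ⟨i, ?_⟩⟩
  change PiNum (σ i) (Subgroup.index _)
  have hle : (A ⊓ K).subgroupOf (A ⊔ N) ≤ (A.subgroupOf (A ⊔ N)).normalCore := by
    intro x hx b
    have hxA : (x : G) ∈ A := hx.1
    have hxK : (x : G) ∈ K := hx.2
    obtain ⟨a, ha, n, hn, e⟩ := Subgroup.mem_sup_of_normal_right.1 b.2
    change (b : G) * x * (b : G)⁻¹ ∈ A
    have hc : n * (x : G) = x * n :=
      Subgroup.commute_of_normal_of_disjoint N K hN hK hd n x hn hxK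
    have : (b : G) * x * (b : G)⁻¹ = a * x * a⁻¹ := by
      rw [← e]
      calc a * n * (x : G) * (a * n)⁻¹ = a * (n * x) * n⁻¹ * a⁻¹ := by group
        _ = _ := by rw [hc]; group
    rw [this]
    exact A.mul_mem (A.mul_mem ha hxA) (A.inv_mem ha)
  refine PiNum.of_dvd ?_ (Subgroup.index_dvd_of_le hle)
  change PiNum (σ i) ((A ⊓ K).relIndex (A ⊔ N))
  rw [← Subgroup.relIndex_mul_relIndex (A ⊓ K) A (A ⊔ N) inf_le_left le_sup_left]
  refine PiNum.mul (hNp.of_dvd ?_) (hNp.of_dvd ?_)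
  · rw [Subgroup.inf_relIndex_left]
    refine (Subgroup.relIndex_dvd_index_of_normal K A).trans ?_
    rw [← Subgroup.relIndex_top_right, ← hs, Subgroup.relIndex_sup_right]
    exact Subgroup.relIndex_dvd_card _ _
  · have e1 : Nat.card A * A.relIndex (A ⊔ N) = Nat.card (A ⊔ N : Subgroup G) := by
      rw [← Subgroup.relIndex_bot_left, ← Subgroup.relIndex_bot_left,
        Subgroup.relIndex_mul_relIndex _ _ _ bot_le le_sup_left]
    have e2 : Nat.card N * N.relIndex A = Nat.card (A ⊔ N : Subgroup G) := by
      rw [← Subgroup.relIndex_sup_right, ← Subgroup.relIndex_bot_left, ← Subgroup.relIndex_bot_left,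
        Subgroup.relIndex_mul_relIndex _ _ _ bot_le le_sup_right]
    apply Nat.dvd_of_mul_dvd_mul_left (Nat.card_pos (α := A))
    rw [e1, ← e2, mul_comm (Nat.card A)]
    exact Nat.mul_dvd_mul_left _ (Subgroup.relIndex_dvd_card _ _)

theorem all_of_nilpotent {ι : Type*} {σ : ι → Set ℕ}
    {G : Type*} [Group G] [Finite G] (h : IsSigmaNilpotent σ G) (A : Subgroup G) :
    IsSigmaSubnormal σ A := by
  obtain ⟨H, hH, hHp, hind, hsup⟩ := h
  induction A using WellFoundedGT.induction with
  | ind A ih =>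
  by_cases hA : A = ⊤
  · exact ⟨0, fun _ => A, rfl, hA, fun k => k.elim0⟩
  have : ∃ i, ¬ H i ≤ A := by
    by_contra hcon
    push Not at hcon
    exact hA (top_le_iff.1 (hsup ▸ iSup_le hcon))
  obtain ⟨i, hi⟩ := this
  refine sigmaSubnormal_of_step (B := A ⊔ H i) ?_ (ih _ ?_)
  · refine step_of_factor i (H i) (⨆ j, ⨆ (_ : j ≠ i), H j) A (hH i) inferInstance (hind i) ?_ (hHp i)
    rw [eq_top_iff, ← hsup]
    refine iSup_le fun j => ?_
    by_cases hj : j = i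
    · subst hj; exact le_sup_left
    · exact le_sup_of_le_right (le_iSup₂_of_le j hj le_rfl)
  · exact lt_of_le_of_ne le_sup_left fun e => hi (e ▸ le_sup_right)

/-- A finite group `G` is σ-nilpotent iff every subgroup of `G` is σ-subnormal. -/
theorem statement_4 {ι : Type*} (σ : ι → Set ℕ) (hσ : IsPrimePartition σ)
    (G : Type*) [Group G] [Finite G] :
    IsSigmaNilpotent σ G ↔ ∀ A : Subgroup G, IsSigmaSubnormal σ A := by
  exact ⟨fun h A => all_of_nilpotent h A, fun h => nilpotent_of_all hσ h⟩
end

section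
/- Let σ be a partition of the primes, G a finite group with a Hall σ_i-subgroup for every σ_i ∈ σ(G), and N ≤ A ≤ G with N normal in G. Then A/N is σ-permutable in G/N if and only if A is σ-permutable in G. -/
open Subgroup
open scoped Pointwise

section Aux

theorem permutes_coe_sup {G : Type*} [Group G] {A B : Subgroup G} (h : Permutes A B) :
    ((A ⊔ B : Subgroup G) : Set G) = (A : Set G) * (B : Set G) := by
  unfold Permutes at h
  let C : Subgroup G :=
    { carrier := (A : Set G) * (B : Set G)
      mul_mem' := by
        rintro x y hx ⟨a, ha, b, hb, rfl⟩
        rw [h] at hx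
        obtain ⟨b', hb', a', ha', rfl⟩ := hx
        have h1 : b' * (a' * a) ∈ (A : Set G) * (B : Set G) := by
          rw [h]; exact ⟨b', hb', a' * a, A.mul_mem ha' ha, rfl⟩
        obtain ⟨a2, ha2, b2, hb2, h2⟩ := h1
        refine ⟨a2, ha2, b2 * b, B.mul_mem hb2 hb, ?_⟩
        simp only at h2 ⊢
        rw [← mul_assoc, h2]; group
      one_mem' := ⟨1, A.one_mem, 1, B.one_mem, by simp⟩
      inv_mem' := by
        rintro x ⟨a, ha, b, hb, rfl⟩
        show (a * b)⁻¹ ∈ (A : Set G) * (B : Set G)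
        rw [h]
        exact ⟨b⁻¹, B.inv_mem hb, a⁻¹, A.inv_mem ha, by simp⟩ }
  apply Set.Subset.antisymm
  · have : A ⊔ B ≤ C := by
      refine sup_le (fun a ha => ?_) (fun b hb => ?_)
      · exact ⟨a, ha, 1, B.one_mem, by simp⟩
      · exact ⟨1, A.one_mem, b, hb, by simp⟩
    exact this
  · rintro x ⟨a, ha, b, hb, rfl⟩
    exact (A ⊔ B).mul_mem (le_sup_left (a := A) ha) (le_sup_right (a := A) hb)

theorem permutes_of_coe_sup {G : Type*} [Group G] {A B : Subgroup G}
    (h : ((A ⊔ B : Subgroup G) : Set G) ⊆ (A : Set G) * (B : Set G)) : Permutes A B := by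
  unfold Permutes
  have h0 : ((A ⊔ B : Subgroup G) : Set G) = (A : Set G) * (B : Set G) := by
    apply Set.Subset.antisymm h
    rintro x ⟨a, ha, b, hb, rfl⟩
    exact (A ⊔ B).mul_mem (le_sup_left (a := A) ha) (le_sup_right (a := A) hb)
  have := congrArg (fun s : Set G => s⁻¹) h0
  simp only [mul_inv_rev, inv_coe_set] at this
  rw [← h0, this]

theorem permutes_of_le_normalizer {G : Type*} [Group G] {A B : Subgroup G}
    (h : ∀ b ∈ B, ∀ a ∈ A, b * a * b⁻¹ ∈ A) : Permutes A B := by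
  unfold Permutes
  ext x; constructor
  · rintro ⟨a, ha, b, hb, rfl⟩
    refine ⟨b, hb, b⁻¹ * a * b, ?_, by simp [mul_assoc]⟩
    simpa using h b⁻¹ (B.inv_mem hb) a ha
  · rintro ⟨b, hb, a, ha, rfl⟩
    exact ⟨b * a * b⁻¹, h b hb a ha, b, hb, by simp⟩

theorem relIndex_sup_of_permutes {G : Type*} [Group G] {A H : Subgroup G} (h : Permutes A H) :
    A.relIndex (A ⊔ H) = A.relIndex H := by
  symm
  refine Nat.card_congr (Equiv.ofBijective
    (quotientSubgroupOfEmbeddingOfLE A (le_sup_right : H ≤ A ⊔ H)) ⟨Function.Embedding.injective _, ?_⟩)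
  intro q
  induction q using QuotientGroup.induction_on with
  | H z =>
    obtain ⟨z, hz⟩ := z
    have hz' : z ∈ ((A ⊔ H : Subgroup G) : Set G) := hz
    rw [permutes_coe_sup h, h] at hz'
    obtain ⟨b, hb, a, ha, rfl⟩ := hz'
    refine ⟨QuotientGroup.mk ⟨b, hb⟩, ?_⟩
    rw [quotientSubgroupOfEmbeddingOfLE_apply_mk, QuotientGroup.eq, mem_subgroupOf]
    simpa using ha

theorem inf_le_of_permutes {G : Type*} [Group G] {A H J : Subgroup G}
    (h : Permutes A H) (h' : Permutes A J) (hc : Nat.Coprime (Nat.card H) (Nat.card J)) :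
    (A ⊔ H) ⊓ (A ⊔ J) ≤ A := by
  rw [← relIndex_eq_one]
  have hA : A ≤ (A ⊔ H) ⊓ (A ⊔ J) := le_inf le_sup_left le_sup_left
  refine Nat.eq_one_of_dvd_coprimes hc ?_ ?_
  · refine (Dvd.intro _ (relIndex_mul_relIndex _ _ _ hA inf_le_left)).trans ?_
    rw [relIndex_sup_of_permutes h]; exact relIndex_dvd_card _ _
  · refine (Dvd.intro _ (relIndex_mul_relIndex _ _ _ hA inf_le_right)).trans ?_
    rw [relIndex_sup_of_permutes h']; exact relIndex_dvd_card _ _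

/-- If `M` contains all `p`-elements of `X` for each prime `p` dividing `|X : X ∩ M|`,
then `X ≤ M`. -/
theorem le_of_pelements {G : Type*} [Group G] [Finite G] {M X : Subgroup G}
    (h : ∀ p : ℕ, p.Prime → p ∣ M.relIndex X → ∀ g ∈ X, (∃ k, g ^ p ^ k = 1) → g ∈ M) :
    X ≤ M := by
  rw [← relIndex_eq_one]
  by_contra hne
  obtain ⟨p, hp, hd⟩ := Nat.exists_prime_and_dvd hne
  haveI : Fact p.Prime := ⟨hp⟩
  let P : Sylow p X := default
  have hle : (P : Subgroup X) ≤ M.subgroupOf X := by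
    intro g hg
    rw [mem_subgroupOf]
    apply h p hp hd g g.2
    obtain ⟨k, hk⟩ := P.isPGroup' ⟨g, hg⟩
    refine ⟨k, ?_⟩
    have := congrArg (fun z : P => ((z : X) : G)) hk
    simpa using this
  exact P.not_dvd_index (hd.trans (index_dvd_of_le hle))

theorem exists_conj_mem_hall {ι : Type*} {σ : ι → Set ℕ} {G : Type*} [Group G] [Finite G]
    {j : ι} {H : Subgroup G} (hH : IsHallSigmaI σ j H) {p : ℕ} (hp : p.Prime) (hpj : p ∈ σ j)
    {g : G} (hg : ∃ k, g ^ p ^ k = 1) : ∃ x : G, g ∈ H.map (MulAut.conj x).toMonoidHom := by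
  haveI : Fact p.Prime := ⟨hp⟩
  let P : Sylow p H := default
  have hP1 : IsPGroup p ((P : Subgroup H).map H.subtype) := P.isPGroup'.map _
  have hP2 : ¬ p ∣ ((P : Subgroup H).map H.subtype).index := by
    rw [index_map_subtype]
    exact hp.not_dvd_mul P.not_dvd_index (fun hd => hH.2 p hp hd hpj)
  let P' : Sylow p G := hP1.toSylow hP2
  have hz : IsPGroup p (zpowers g) := by
    obtain ⟨k, hk⟩ := hg
    rintro ⟨y, hy⟩
    obtain ⟨n, rfl⟩ := mem_zpowers_iff.mp hy
    refine ⟨k, ?_⟩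
    ext
    simp only [SubmonoidClass.mk_pow, OneMemClass.coe_one]
    rw [← zpow_natCast, ← zpow_mul, mul_comm, zpow_mul, zpow_natCast, hk, one_zpow]
  obtain ⟨Q, hQ⟩ := hz.exists_le_sylow
  obtain ⟨x, hx⟩ := MulAction.exists_smul_eq G P' Q
  refine ⟨x, ?_⟩
  have hgQ : g ∈ Q := hQ (mem_zpowers g)
  rw [← hx] at hgQ
  have hg2 : g ∈ ((x • P' : Sylow p G) : Subgroup G) := hgQ
  rw [Sylow.coe_subgroup_smul, Subgroup.pointwise_smul_def] at hg2
  obtain ⟨y, hy, rfl⟩ := hg2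
  refine ⟨y, ?_, rfl⟩
  have : y ∈ (P : Subgroup H).map H.subtype := hy
  obtain ⟨w, _, rfl⟩ := this
  exact w.2

theorem permutes_hall_of_family {ι : Type*} {σ : ι → Set ℕ} (hσ : IsPrimePartition σ)
    {G : Type*} [Group G] [Finite G] (A : Subgroup G) (R : ι → Subgroup G → Prop)
    (hR : ∀ i, ∃ H, R i H) (hhall : ∀ i H, R i H → IsHallSigmaI σ i H)
    (hconj : ∀ i H x, R i H → R i (H.map (MulAut.conj x).toMonoidHom))
    (hperm : ∀ i H, R i H → Permutes A H) : IsSigmaPermutable σ A := by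
  intro i K hK
  -- `p`-elements with `p ∉ σ i` of `A ⊔ H` lie in `A`
  have key : ∀ H, R i H → ∀ p : ℕ, p.Prime → p ∉ σ i → ∀ g ∈ A ⊔ H, (∃ k, g ^ p ^ k = 1) →
      g ∈ A := by
    intro H hH p hp hpi g hg hgk
    obtain ⟨j, hj, -⟩ := hσ.existsUnique_mem p hp
    obtain ⟨J, hJ⟩ := hR j
    obtain ⟨x, hx⟩ := exists_conj_mem_hall (hhall j J hJ) hp hj hgk
    have hJ' := hconj j J x hJ
    refine inf_le_of_permutes (hperm i H hH) (hperm j _ hJ') ?_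
      (mem_inf.mpr ⟨hg, le_sup_right (a := A) hx⟩)
    refine Nat.Coprime.symm (Nat.coprime_of_dvd fun q hq h1 h2 => ?_)
    have hqi := (hhall i H hH).1 q hq h2
    have hqj := (hhall j _ hJ').1 q hq h1
    have := (hσ.existsUnique_mem q hq).unique hqi hqj
    subst this
    exact hpi hj
  let S : Set G := {a | a ∈ A ∧ ∃ p : ℕ, p.Prime ∧ p ∉ σ i ∧ ∃ k, a ^ p ^ k = 1}
  let V : Subgroup G := closure S
  have hVA : V ≤ A := (closure_le _).mpr fun a ha => ha.1
  have hHV : ∀ H, R i H → ∀ x ∈ H, ∀ v ∈ V, x * v * x⁻¹ ∈ V := by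
    intro H hH x hx v hv
    have : V ≤ V.comap (MulAut.conj x).toMonoidHom := by
      refine (closure_le _).mpr ?_
      rintro a ⟨ha, p, hp, hpi, k, hk⟩
      have h1 : (x * a * x⁻¹) ^ p ^ k = 1 := by rw [conj_pow, hk]; simp
      have hxx : x ∈ A ⊔ H := le_sup_right (a := A) hx
      have h2 : x * a * x⁻¹ ∈ A ⊔ H :=
        mul_mem (mul_mem hxx (le_sup_left (a := A) ha)) (inv_mem hxx)
      exact subset_closure ⟨key H hH p hp hpi _ h2 ⟨k, h1⟩, p, hp, hpi, k, h1⟩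
    exact this hv
  -- the normalizing subgroup
  have hKV : ∀ x ∈ K, ∀ v ∈ V, x * v * x⁻¹ ∈ V := by
    have hle : K ≤ normalizer (V : Set G) := by
      apply le_of_pelements
      intro p hp hd g hg hgk
      have hpi : p ∈ σ i := hK.1 p hp (hd.trans (relIndex_dvd_card _ _))
      obtain ⟨H, hH⟩ := hR i
      obtain ⟨x, hx⟩ := exists_conj_mem_hall (hhall i H hH) hp hpi hgk
      have h1 := hHV _ (hconj i H x hH)
      rw [mem_normalizer_iff]
      intro v
      refine ⟨h1 g hx v, fun hv => ?_⟩
      have := h1 g⁻¹ (inv_mem hx) _ hv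
      simpa [mul_assoc] using this
    intro x hx v hv
    exact (mem_normalizer_iff.mp (hle hx) v).mp hv
  have hAVH : ∀ H, R i H → A ≤ V ⊔ H := by
    intro H hH
    refine le_trans (le_sup_left : A ≤ A ⊔ H) (le_of_pelements ?_)
    intro p hp hd g hg hgk
    have hpi : p ∉ σ i := by
      refine (hhall i H hH).2 p hp (hd.trans ?_)
      exact (relIndex_dvd_index_of_le (sup_le_sup_right hVA H)).trans
        (index_dvd_of_le le_sup_right)
    exact le_sup_left (a := V) (subset_closure ⟨key H hH p hp hpi g hg hgk, p, hp, hpi, hgk⟩)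
  let D : Subgroup G := ⨅ H : {H // R i H}, V ⊔ (H : Subgroup G)
  have hAD : A ≤ D := le_iInf fun H => hAVH H.1 H.2
  have hKD : ∀ x ∈ K, ∀ d ∈ D, x * d * x⁻¹ ∈ D := by
    intro x hx d hd
    rw [mem_iInf]
    rintro ⟨H, hH⟩
    have h1 := mem_iInf.mp hd ⟨_, hconj i H x⁻¹ hH⟩
    have h2 : V ⊔ H.map (MulAut.conj x⁻¹).toMonoidHom ≤
        (V ⊔ H).comap (MulAut.conj x).toMonoidHom := by
      refine sup_le (fun v hv => ?_) ?_
      · exact le_sup_left (a := V) (hKV x hx v hv)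
      · rintro _ ⟨y, hy, rfl⟩
        refine le_sup_right (a := V) ?_
        simpa [mul_assoc] using hy
    exact h2 h1
  have hDK : D ≤ V ⊔ K := by
    apply le_of_pelements
    intro p hp hd g hg hgk
    have hVD : V ≤ D := hVA.trans hAD
    have hpm : Permutes (V ⊔ K) D := by
      have : Permutes D (V ⊔ K) := by
        apply permutes_of_le_normalizer
        have hle : V ⊔ K ≤ normalizer (D : Set G) := by
          refine sup_le (hVD.trans le_normalizer) fun x hx => ?_
          rw [mem_normalizer_iff]
          intro d
          refine ⟨hKD x hx d, fun hd => ?_⟩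
          have := hKD x⁻¹ (inv_mem hx) _ hd
          simpa [mul_assoc] using this
        intro b hb a ha
        exact (mem_normalizer_iff.mp (hle hb) a).mp ha
      exact Eq.symm this
    have hpi : p ∉ σ i := by
      refine hK.2 p hp (hd.trans ?_)
      rw [← relIndex_sup_of_permutes hpm]
      exact (relIndex_dvd_index_of_le le_sup_left).trans (index_dvd_of_le le_sup_right)
    obtain ⟨H, hH⟩ := hR i
    have h1 := mem_iInf.mp hg ⟨H, hH⟩
    have h2 := key H hH p hp hpi g (sup_le_sup_right hVA H h1) hgk
    exact le_sup_left (a := V) (subset_closure ⟨h2, p, hp, hpi, hgk⟩)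
  apply permutes_of_coe_sup
  have h1 : A ⊔ K ≤ V ⊔ K := sup_le (hAD.trans hDK) le_sup_right
  have h2 : ((V ⊔ K : Subgroup G) : Set G) = (V : Set G) * (K : Set G) :=
    permutes_coe_sup (permutes_of_le_normalizer hKV)
  intro z hz
  have h3 : z ∈ ((V ⊔ K : Subgroup G) : Set G) := h1 hz
  rw [h2] at h3
  exact Set.mul_subset_mul_right (show (V : Set G) ⊆ A from hVA) h3

theorem hall_map {ι : Type*} {σ : ι → Set ℕ} {G G' : Type*} [Group G] [Group G']
    {i : ι} {H : Subgroup G} (hH : IsHallSigmaI σ i H) (f : G →* G')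
    (hf : Function.Surjective f) : IsHallSigmaI σ i (H.map f) :=
  ⟨fun p hp hd => hH.1 p hp (hd.trans (card_map_dvd _ f)),
    fun p hp hd => hH.2 p hp (hd.trans (index_map_dvd _ hf))⟩

theorem permutes_map {G G' : Type*} [Group G] [Group G'] {A H : Subgroup G}
    (h : Permutes A H) (f : G →* G') : Permutes (A.map f) (H.map f) := by
  unfold Permutes at *
  simp only [coe_map, ← Set.image_mul, h]

end Aux

/-- Let `G` be σ-full, `N ≤ A` with `N ⊴ G`. Then `A/N` is σ-permutable in `G/N`
iff `A` is σ-permutable in `G`. -/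
theorem statement_9 {ι : Type*} (σ : ι → Set ℕ) (hσ : IsPrimePartition σ)
    {G : Type*} [Group G] [Finite G] (hfull : IsSigmaFull σ G)
    (N A : Subgroup G) [hN : N.Normal] (hNA : N ≤ A) :
    IsSigmaPermutable σ (A.map (QuotientGroup.mk' N)) ↔ IsSigmaPermutable σ A := by
  have hsurj := QuotientGroup.mk'_surjective N
  constructor
  · intro h i H hH
    have h1 := h i _ (hall_map hH (QuotientGroup.mk' N) hsurj)
    apply permutes_of_coe_sup
    intro z hz
    have h2 : QuotientGroup.mk' N z ∈
        ((A.map (QuotientGroup.mk' N) ⊔ H.map (QuotientGroup.mk' N) : Subgroup (G ⧸ N)) :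
          Set (G ⧸ N)) := by
      rw [← Subgroup.map_sup]; exact ⟨z, hz, rfl⟩
    rw [permutes_coe_sup h1, h1] at h2
    rw [← h1] at h2
    obtain ⟨_, ⟨a, ha, rfl⟩, _, ⟨b, hb, rfl⟩, hab⟩ := h2
    have h3 : z * (a * b)⁻¹ ∈ N := by
      rw [← QuotientGroup.ker_mk' N, MonoidHom.mem_ker, map_mul, map_inv, ← hab]
      simp
    refine ⟨z * (a * b)⁻¹ * a, A.mul_mem (hNA h3) ha, b, hb, by group⟩
  · intro h
    refine permutes_hall_of_family hσ _
      (fun i H' => ∃ H, IsHallSigmaI σ i H ∧ H' = H.map (QuotientGroup.mk' N)) ?_ ?_ ?_ ?_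
    · intro i
      by_cases hi : ∃ p : ℕ, p.Prime ∧ p ∈ σ i ∧ p ∣ Nat.card G
      · obtain ⟨H, hH⟩ := hfull i hi
        exact ⟨_, H, hH, rfl⟩
      · refine ⟨_, ⊥, ⟨fun p hp hd => ?_, fun p hp hd hpi => ?_⟩, rfl⟩
        · simp at hd; exact absurd hd hp.ne_one
        · rw [index_bot] at hd
          exact hi ⟨p, hp, hpi, hd⟩
    · rintro i _ ⟨H, hH, rfl⟩
      exact hall_map hH _ hsurj
    · rintro i _ x ⟨H, hH, rfl⟩
      obtain ⟨y, rfl⟩ := hsurj x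
      refine ⟨H.map (MulAut.conj y).toMonoidHom,
        hall_map hH _ (MulAut.conj y).surjective, ?_⟩
      rw [Subgroup.map_map, Subgroup.map_map]
      congr 1
    · rintro i _ ⟨H, hH, rfl⟩
      exact permutes_map (h i H hH) _
end

section
/- Let σ be a partition of the primes, G a σ-full finite group, A a σ-permutable subgroup of G, and B a σ-subnormal subgroup of G with A ≤ B. Then A is σ-permutable in B. -/
open Subgroup
open scoped Pointwise

def Perm {G : Type*} [Group G] (A B : Subgroup G) : Prop :=
  ∀ a ∈ A, ∀ b ∈ B, ∃ b' ∈ B, ∃ a' ∈ A, a * b = b' * a'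

theorem Perm.symm {G : Type*} [Group G] {A B : Subgroup G} (h : Perm A B) : Perm B A := by
  intro b hb a ha
  obtain ⟨b', hb', a', ha', e⟩ := h a⁻¹ (inv_mem ha) b⁻¹ (inv_mem hb)
  refine ⟨a'⁻¹, inv_mem ha', b'⁻¹, inv_mem hb', ?_⟩
  rw [← mul_inv_rev, ← e]; group

theorem perm_iff {G : Type*} [Group G] {A B : Subgroup G} : Permutes A B ↔ Perm A B := by
  constructor
  · intro h a ha b hb
    have : a * b ∈ (A : Set G) * (B : Set G) := Set.mul_mem_mul ha hb
    rw [h] at this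
    obtain ⟨b', hb', a', ha', e⟩ := this
    exact ⟨b', hb', a', ha', e.symm⟩
  · intro h
    apply Set.Subset.antisymm
    · rintro _ ⟨a, ha, b, hb, rfl⟩
      obtain ⟨b', hb', a', ha', e⟩ := h a ha b hb
      exact ⟨b', hb', a', ha', e.symm⟩
    · rintro _ ⟨b, hb, a, ha, rfl⟩
      obtain ⟨b', hb', a', ha', e⟩ := h.symm b hb a ha
      exact ⟨b', hb', a', ha', e.symm⟩

/-- elements of a join of permuting subgroups -/
theorem Perm.mem_sup {G : Type*} [Group G] {A B : Subgroup G} (h : Perm A B) {x : G}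
    (hx : x ∈ A ⊔ B) : ∃ a ∈ A, ∃ b ∈ B, x = a * b := by
  rw [sup_eq_closure] at hx
  induction hx using Subgroup.closure_induction with
  | mem x hx =>
    rcases hx with hx | hx
    · exact ⟨x, hx, 1, one_mem _, by simp⟩
    · exact ⟨1, one_mem _, x, hx, by simp⟩
  | one => exact ⟨1, one_mem _, 1, one_mem _, by simp⟩
  | mul x y _ _ ihx ihy =>
    obtain ⟨a, ha, b, hb, rfl⟩ := ihx
    obtain ⟨c, hc, d, hd, rfl⟩ := ihy
    obtain ⟨c', hc', b', hb', e⟩ := h.symm b hb c hc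
    refine ⟨a * c', mul_mem ha hc', b' * d, mul_mem hb' hd, ?_⟩
    calc a * b * (c * d) = a * (b * c) * d := by group
      _ = _ := by rw [e]; group
  | inv x _ ih =>
    obtain ⟨a, ha, b, hb, rfl⟩ := ih
    obtain ⟨a', ha', b', hb', e⟩ := h.symm b⁻¹ (inv_mem hb) a⁻¹ (inv_mem ha)
    exact ⟨a', ha', b', hb', by rw [← e]; group⟩

theorem Perm.sup {G : Type*} [Group G] {A B C : Subgroup G} (hA : Perm A C) (hB : Perm B C) :
    Perm (A ⊔ B) C := by
  intro x hx
  rw [sup_eq_closure] at hx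
  induction hx using Subgroup.closure_induction with
  | mem x hx =>
    intro c hc
    rcases hx with hx | hx
    · obtain ⟨b', hb', a', ha', e⟩ := hA x hx c hc
      exact ⟨b', hb', a', mem_sup_left ha', e⟩
    · obtain ⟨b', hb', a', ha', e⟩ := hB x hx c hc
      exact ⟨b', hb', a', mem_sup_right ha', e⟩
  | one => intro c hc; exact ⟨c, hc, 1, one_mem _, by simp⟩
  | mul x y _ _ ihx ihy =>
    intro c hc
    obtain ⟨c1, hc1, y1, hy1, e1⟩ := ihy c hc
    obtain ⟨c2, hc2, x2, hx2, e2⟩ := ihx c1 hc1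
    refine ⟨c2, hc2, x2 * y1, mul_mem hx2 hy1, ?_⟩
    rw [mul_assoc, e1, ← mul_assoc, e2, mul_assoc]
  | inv x hx _ =>
    intro c hc
    have hx' : x ∈ A ⊔ B := by rw [sup_eq_closure]; exact hx
    have key : Perm C (A ⊔ B) := by
      intro c hc y hy
      rw [sup_eq_closure] at hy
      revert c
      induction hy using Subgroup.closure_induction_left with
      | one => intro c hc; exact ⟨1, one_mem _, c, hc, by simp⟩
      | mul_left x hx y hy ih =>
        intro c hc
        rcases hx with hx | hx
        · obtain ⟨a', ha', c', hc', e⟩ := hA.symm c hc x hx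
          obtain ⟨a2, ha2, c2, hc2, e2⟩ := ih c' hc'
          refine ⟨a' * a2, mul_mem (mem_sup_left ha') ha2, c2, hc2, ?_⟩
          rw [← mul_assoc, e, mul_assoc, e2, mul_assoc]
        · obtain ⟨a', ha', c', hc', e⟩ := hB.symm c hc x hx
          obtain ⟨a2, ha2, c2, hc2, e2⟩ := ih c' hc'
          refine ⟨a' * a2, mul_mem (mem_sup_right ha') ha2, c2, hc2, ?_⟩
          rw [← mul_assoc, e, mul_assoc, e2, mul_assoc]
      | inv_mul_cancel x hx y hy ih =>
        intro c hc
        rcases hx with hx | hx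
        · obtain ⟨a', ha', c', hc', e⟩ := hA.symm c hc x⁻¹ (inv_mem hx)
          obtain ⟨a2, ha2, c2, hc2, e2⟩ := ih c' hc'
          refine ⟨a' * a2, mul_mem (mem_sup_left ha') ha2, c2, hc2, ?_⟩
          rw [← mul_assoc, e, mul_assoc, e2, mul_assoc]
        · obtain ⟨a', ha', c', hc', e⟩ := hB.symm c hc x⁻¹ (inv_mem hx)
          obtain ⟨a2, ha2, c2, hc2, e2⟩ := ih c' hc'
          refine ⟨a' * a2, mul_mem (mem_sup_right ha') ha2, c2, hc2, ?_⟩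
          rw [← mul_assoc, e, mul_assoc, e2, mul_assoc]
    exact key.symm x⁻¹ (inv_mem hx') c hc

theorem perm_of_le_normalizer {G : Type*} [Group G] {A B : Subgroup G}
    (h : ∀ b ∈ B, ∀ a ∈ A, b * a * b⁻¹ ∈ A) : Perm A B := by
  intro a ha b hb
  refine ⟨b, hb, b⁻¹ * a * b, ?_, by group⟩
  simpa using h b⁻¹ (inv_mem hb) a ha

theorem mem_cj {G : Type*} [Group G] {A : Subgroup G} {g x : G} :
    x ∈ MulAut.conj g • A ↔ g⁻¹ * x * g ∈ A := by
  rw [mem_pointwise_smul_iff_inv_smul_mem, ← map_inv]; simp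

theorem Perm.conj {G : Type*} [Group G] {A B : Subgroup G} (h : Perm A B) (g : G) :
    Perm (MulAut.conj g • A) (MulAut.conj g • B) := by
  intro a ha b hb
  rw [mem_cj] at ha hb
  obtain ⟨b', hb', a', ha', e⟩ := h _ ha _ hb
  refine ⟨g * b' * g⁻¹, by rw [mem_cj]; simpa [mul_assoc] using hb', g * a' * g⁻¹,
    by rw [mem_cj]; simpa [mul_assoc] using ha', ?_⟩
  calc a * b = g * (g⁻¹ * a * g * (g⁻¹ * b * g)) * g⁻¹ := by group
    _ = _ := by rw [e]; group

theorem Perm.relIndex {G : Type*} [Group G] [Finite G] {A H : Subgroup G} (h : Perm A H) :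
    A.relIndex (A ⊔ H) = A.relIndex H := by
  symm
  refine Nat.card_congr (Equiv.ofBijective
    (Subgroup.quotientSubgroupOfEmbeddingOfLE A (le_sup_right : H ≤ A ⊔ H))
    ⟨(Subgroup.quotientSubgroupOfEmbeddingOfLE A _).injective, ?_⟩)
  intro q
  induction q using QuotientGroup.induction_on with
  | H z =>
    obtain ⟨z, hz⟩ := z
    rw [sup_comm] at hz
    obtain ⟨b, hb, a, ha, e⟩ := h.symm.mem_sup hz
    refine ⟨QuotientGroup.mk ⟨b, hb⟩, ?_⟩
    rw [Subgroup.quotientSubgroupOfEmbeddingOfLE_apply_mk]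
    rw [QuotientGroup.eq]
    simp [mem_subgroupOf, e, ha]

theorem mem_of_coprime {G : Type*} [Group G] [Finite G] {N : Subgroup G} [N.Normal] {x : G}
    (h : ∀ p : ℕ, p.Prime → p ∣ orderOf x → p ∣ N.index → False) : x ∈ N := by
  have hc : (orderOf x).Coprime N.index := Nat.Coprime.symm (Nat.coprime_of_dvd (by
    intro p hp h1 h2; exact h p hp h2 h1))
  have h1 : x ^ N.index ∈ N := N.pow_index_mem x
  have := zpow_mem h1 (Nat.gcdB (orderOf x) N.index)
  have e : x ^ ((orderOf x : ℤ) * Nat.gcdA (orderOf x) N.index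
      + (N.index : ℤ) * Nat.gcdB (orderOf x) N.index) = x := by
    rw [← Nat.gcd_eq_gcd_ab, hc]; simp
  rw [zpow_add, zpow_mul, zpow_mul, zpow_natCast, pow_orderOf_eq_one, one_zpow, one_mul,
    zpow_natCast] at e
  rwa [e] at this

theorem eq_top_of_index {G : Type*} [Group G] [Finite G] {N : Subgroup G}
    (h : ∀ p : ℕ, p.Prime → ¬ p ∣ N.index) : N = ⊤ := by
  rw [← Subgroup.index_eq_one]
  exact Nat.eq_one_iff_not_exists_prime_dvd.2 h

theorem le_of_relIndex {G : Type*} [Group G] [Finite G] {N L : Subgroup G}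
    (h : ∀ p : ℕ, p.Prime → ¬ p ∣ N.relIndex L) : L ≤ N := by
  rw [← Subgroup.relIndex_eq_one]
  exact Nat.eq_one_iff_not_exists_prime_dvd.2 h

theorem sup_conj_ne_top {G : Type*} [Group G] {A B : Subgroup G} {x : G}
    (hp : Perm A (MulAut.conj x • B)) (h : A ⊔ MulAut.conj x • B = ⊤) : A ⊔ B = ⊤ := by
  have hx : x ∈ (MulAut.conj x • B) ⊔ A := by rw [sup_comm, h]; trivial
  obtain ⟨c, hc, a, ha, e⟩ := hp.symm.mem_sup hx
  rw [mem_cj] at hc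
  have hxm : x ∈ A ⊔ B := by
    have : x = a * (x⁻¹ * c * x) := by
      have h2 : c = x * a⁻¹ := eq_mul_inv_of_mul_eq e.symm
      rw [h2]; group
    rw [this]
    exact mul_mem (mem_sup_left ha) (mem_sup_right hc)
  rw [eq_top_iff, ← h, sup_le_iff]
  refine ⟨le_sup_left, fun y hy => ?_⟩
  rw [mem_cj] at hy
  have := mul_mem (mul_mem hxm (mem_sup_right hy : _ ∈ A ⊔ B)) (inv_mem hxm)
  simpa [mul_assoc] using this

theorem kegel {G : Type*} [Group G] [Finite G] {A B : Subgroup G}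
    (hp : ∀ x : G, Perm A (MulAut.conj x • B)) (hne : A ⊔ B ≠ ⊤) :
    ∃ C : Subgroup G, A ≤ C ∧ C ≠ ⊤ ∧
      ∀ x : G, ∀ b ∈ MulAut.conj x • B, ∀ a ∈ C, b * a * b⁻¹ ∈ C := by
  let S : Set (Subgroup G) := {C | A ≤ C ∧ (∀ x : G, Perm C (MulAut.conj x • B)) ∧ C ⊔ B ≠ ⊤}
  have hA : A ∈ S := ⟨le_rfl, hp, hne⟩
  obtain ⟨C, hAC, hC⟩ := (Set.toFinite S).exists_le_maximal hA
  refine ⟨C, hAC, ?_, ?_⟩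
  · intro h
    exact hC.1.2.2 (by rw [h, top_sup_eq])
  · intro x b hb a ha
    have hD : C ⊔ MulAut.conj b • C ∈ S := by
      have hperm : ∀ y : G, Perm (C ⊔ MulAut.conj b • C) (MulAut.conj y • B) := by
        intro y
        refine (hC.1.2.1 y).sup ?_
        have := (hC.1.2.1 (b⁻¹ * y)).conj b
        rwa [smul_smul, ← map_mul, mul_inv_cancel_left] at this
      refine ⟨hAC.trans le_sup_left, hperm, ?_⟩
      intro h
      have h1 : C ⊔ MulAut.conj x • B = ⊤ := by
        have h2 : C ⊔ MulAut.conj b • C ≤ C ⊔ MulAut.conj x • B := by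
          refine sup_le le_sup_left fun y hy => ?_
          rw [mem_cj] at hy
          have hbm : b ∈ C ⊔ MulAut.conj x • B := mem_sup_right hb
          have := mul_mem (mul_mem hbm (mem_sup_left hy : _ ∈ C ⊔ MulAut.conj x • B))
            (inv_mem hbm)
          simpa [mul_assoc] using this
        have h3 : C ⊔ MulAut.conj b • C ⊔ MulAut.conj x • B = ⊤ := by
          have hB : MulAut.conj x⁻¹ • MulAut.conj x • B = B := by
            rw [smul_smul, ← map_mul, inv_mul_cancel, map_one, one_smul]
          have h1 := hperm 1
          rw [map_one, one_smul] at h1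
          exact sup_conj_ne_top (x := x⁻¹) (by rwa [hB]) (by rwa [hB])
        exact eq_top_iff.2 (h3 ▸ sup_le h2 le_sup_right)
      exact hC.1.2.2 (sup_conj_ne_top (hC.1.2.1 x) h1)
    have := hC.2 hD le_sup_left
    apply this
    apply mem_sup_right
    rw [mem_cj]
    simpa [mul_assoc] using ha

def PP {ι : Type*} (σ : ι → Set ℕ) {G : Type*} [Group G] (A : Subgroup G) : Prop :=
  ∀ i, ∀ L : Subgroup G, IsSigmaNumber σ i (A.relIndex L) → ∀ x ∈ L,
    (∀ p : ℕ, p.Prime → p ∣ orderOf x → p ∉ σ i) → x ∈ A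

def WW {ι : Type*} (σ : ι → Set ℕ) {G : Type*} [Group G] (A : Subgroup G)
    (H : ι → Subgroup G) : Prop :=
  (∀ i, IsHallSigmaI σ i (H i)) ∧ ∀ i, ∀ x : G, Perm A (MulAut.conj x • H i)

theorem PP.trans {ι : Type*} {σ : ι → Set ℕ} {G : Type*} [Group G] {A U : Subgroup G}
    (hAU : A ≤ U) (h1 : PP σ U) (h2 : PP σ (A.subgroupOf U)) : PP σ A := by
  intro i L hL x hx hox
  have hxU : x ∈ U := h1 i L (fun p hp hd => hL p hp (hd.trans (relIndex_dvd_of_le_left L hAU)))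
    x hx hox
  have := h2 i ((L ⊓ U).subgroupOf U) (fun p hp hd => hL p hp ?_) ⟨x, hxU⟩
    (by simp [mem_subgroupOf, hx, hxU]) (by simpa [Subgroup.orderOf_mk] using hox)
  · simpa [mem_subgroupOf] using this
  · rw [relIndex_subgroupOf inf_le_right] at hd
    have := relIndex_inf_mul_relIndex A U L
    rw [inf_eq_left.2 hAU, inf_comm] at this
    exact hd.trans ⟨_, this.symm⟩

theorem PP.of_normal {ι : Type*} {σ : ι → Set ℕ} {G : Type*} [Group G] [Finite G]
    {A : Subgroup G} [A.Normal] : PP σ A := by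
  intro i L hL x hx hox
  have : (⟨x, hx⟩ : L) ∈ A.subgroupOf L := by
    apply mem_of_coprime
    intro p hp h1 h2
    rw [Subgroup.orderOf_mk] at h1
    exact hox p hp h1 (hL p hp h2)
  simpa [mem_subgroupOf] using this

theorem WW.restrict {ι : Type*} {σ : ι → Set ℕ} {G : Type*} [Group G] [Finite G]
    {A U : Subgroup G} {H : ι → Subgroup G} (hW : WW σ A H) (hU : ∀ i, Perm U (H i))
    (hAU : A ≤ U) : WW σ (A.subgroupOf U) (fun i => (H i).subgroupOf U) := by
  refine ⟨fun i => ⟨fun p hp hd => (hW.1 i).1 p hp (hd.trans ?_), fun p hp hd =>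
    (hW.1 i).2 p hp (hd.trans ?_)⟩, ?_⟩
  · exact card_comap_dvd_of_injective (H i) U.subtype U.subtype_injective
  · change (H i).relIndex U ∣ _
    rw [← (hU i).symm.relIndex]
    exact relIndex_dvd_index_of_le le_sup_left
  · intro i u a ha b hb
    rw [mem_cj, mem_subgroupOf] at hb
    rw [mem_subgroupOf] at ha
    obtain ⟨b', hb', a', ha', e⟩ := hW.2 i u a ha b (by rw [mem_cj]; exact hb)
    have hbU : b' ∈ U := by
      have : b' = a * b * a'⁻¹ := by rw [e]; group
      rw [this]
      exact mul_mem (mul_mem a.2 b.2) (inv_mem (hAU ha'))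
    refine ⟨⟨b', hbU⟩, ?_, ⟨a', hAU ha'⟩, ?_, ?_⟩
    · rw [mem_cj] at hb' ⊢
      exact hb'
    · exact ha'
    · ext; exact e

theorem nc_le {G : Type*} [Group G] {C H : Subgroup G}
    (h : ∀ x : G, ∀ b ∈ MulAut.conj x • H, ∀ a ∈ C, b * a * b⁻¹ ∈ C) :
    normalClosure (H : Set G) ≤ normalizer (C : Set G) := by
  rw [normalClosure, closure_le]
  intro y hy
  rw [Group.mem_conjugatesOfSet_iff] at hy
  obtain ⟨z, hz, hzy⟩ := hy
  obtain ⟨g, rfl⟩ := isConj_iff.1 hzy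
  have hb : g * z * g⁻¹ ∈ MulAut.conj g • H := by
    rw [mem_cj]; simpa [mul_assoc] using hz
  rw [SetLike.mem_coe, mem_normalizer_iff]
  intro n
  refine ⟨h g _ hb n, fun hn => ?_⟩
  have := h g _ (inv_mem hb) _ hn
  simpa [mul_assoc] using this

theorem WW.main {ι : Type*} (σ : ι → Set ℕ) (hσ : IsPrimePartition σ) (n : ℕ) :
    ∀ m : ℕ, ∀ {G : Type*} [Group G] [Finite G] (A : Subgroup G) (H : ι → Subgroup G),
    Nat.card G ≤ n → A.index ≤ m → WW σ A H → PP σ A := by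
  induction n with
  | zero =>
    intro m G _ _ A H h
    have := Nat.card_pos (α := G)
    omega
  | succ n ihn =>
  intro m
  induction m with
  | zero =>
    intro G _ _ A H _ h
    have := A.index_ne_zero_of_finite
    omega
  | succ m ihm =>
  intro G _ _ A H hG hm hW
  have hcard : ∀ U : Subgroup G, U ≠ ⊤ → Nat.card U ≤ n := by
    intro U hU
    have h1 : Nat.card U < Nat.card G :=
      lt_of_le_of_ne (Subgroup.card_le_card_group U) (fun h => hU ((Subgroup.card_eq_iff_eq_top U).1 h))
    omega
  have hH : ∀ i, Perm A (H i) := fun i => by simpa using hW.2 i 1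
  by_cases hAt : A = ⊤
  · subst hAt; exact PP.of_normal
  by_cases hN : normalClosure (A : Set G) = ⊤
  swap
  · have hle : A ≤ normalClosure (A : Set G) := subset_normalClosure
    refine PP.trans hle PP.of_normal
      (ihn _ _ _ (hcard _ hN) le_rfl (hW.restrict (fun i => perm_of_le_normalizer ?_) hle))
    intro b _ a ha
    exact normalClosure_normal.conj_mem a ha b
  by_cases hex : ∃ j, A ⊔ H j ≠ ⊤ ∧ ¬ H j ≤ A.normalCore
  · obtain ⟨j, hj, hjA⟩ := hex
    obtain ⟨C, hAC, hC, hnorm⟩ := kegel (hW.2 j) hj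
    set M := normalClosure (H j : Set G) with hM
    have hMC : M ≤ normalizer (C : Set G) := nc_le hnorm
    have hMA : ¬ M ≤ A := fun h => hjA
      ((subset_normalClosure).trans (normal_le_normalCore.2 h))
    have hAM : A ⊔ M ≠ ⊤ := by
      intro h
      have h1 : normalizer (C : Set G) = ⊤ :=
        eq_top_iff.2 (h ▸ sup_le (hAC.trans le_normalizer) hMC)
      have h2 : C.Normal := normalizer_eq_top_iff.1 h1
      exact hC (eq_top_iff.2 (hN ▸ normalClosure_le_normal hAC))
    have hMP : ∀ K : Subgroup G, Perm M K := fun K => perm_of_le_normalizer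
      (fun b _ a ha => normalClosure_normal.conj_mem a ha b)
    have hlt : (A ⊔ M).index < A.index := by
      have h1 := relIndex_mul_index (le_sup_left : A ≤ A ⊔ M)
      have h2 : A.relIndex (A ⊔ M) ≠ 1 := fun h =>
        hMA (le_sup_right.trans (relIndex_eq_one.1 h))
      have h3 := A.index_ne_zero_of_finite
      have h4 : A.relIndex (A ⊔ M) ≠ 0 := fun h => h3 (by rw [← h1, h, zero_mul])
      have h5 : 2 ≤ A.relIndex (A ⊔ M) := by omega
      have h6 : 0 < (A ⊔ M).index := Nat.pos_of_ne_zero (A ⊔ M).index_ne_zero_of_finite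
      nlinarith
    refine PP.trans (le_sup_left : A ≤ A ⊔ M)
      (ihm _ H hG (by omega) ⟨hW.1, fun i x => (hW.2 i x).sup (hMP _)⟩)
      (ihn _ _ _ (hcard _ hAM) le_rfl (hW.restrict (fun i => (hH i).sup (hMP _)) le_sup_left))
  · push Not at hex
    obtain ⟨p, hp, hpA⟩ := Nat.exists_prime_and_dvd (n := A.index) (by rwa [Ne, index_eq_one])
    obtain ⟨k, hk, huniq⟩ := hσ.existsUnique_mem p hp
    have hidx : ∀ j, A ⊔ H j = ⊤ → IsSigmaNumber σ j A.index := by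
      intro j hj q hq hd
      have := (hH j).relIndex
      rw [hj, relIndex_top_right] at this
      rw [this] at hd
      exact (hW.1 j).1 q hq (hd.trans (relIndex_dvd_card _ _))
    have hcore : ∀ j, j ≠ k → H j ≤ A.normalCore := by
      intro j hj
      by_contra hcon
      exact hj (huniq _ (hidx j (by_contra fun h => hcon (hex j h)) p hp hpA))
    have hNk : IsSigmaNumber σ k A.normalCore.index := by
      intro q hq hd
      obtain ⟨j, hj, -⟩ := hσ.existsUnique_mem q hq
      by_cases hjk : j = k
      · exact hjk ▸ hj
      · exact absurd hj ((hW.1 j).2 q hq (hd.trans (index_dvd_of_le (hcore j hjk))))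
    intro i L hL x hx hox
    by_cases hik : i = k
    · subst hik
      apply normalCore_le A
      apply mem_of_coprime
      intro q hq h1 h2
      exact hox q hq h1 (hNk q hq h2)
    · refine (le_of_relIndex ?_ : L ≤ A) hx
      intro q hq hd
      have h1 := hL q hq hd
      have h2 := hNk q hq ((hd.trans (relIndex_dvd_of_le_left L (normalCore_le A))).trans
        (relIndex_dvd_index_of_normal _ _))
      obtain ⟨j, hj, hu⟩ := hσ.existsUnique_mem q hq
      exact hik ((hu _ h1).trans (hu _ h2).symm)

theorem hall_conj {ι : Type*} {σ : ι → Set ℕ} {G : Type*} [Group G] {i : ι} {H : Subgroup G}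
    (h : IsHallSigmaI σ i H) (g : G) : IsHallSigmaI σ i (MulAut.conj g • H) := by
  have h1 : Nat.card (MulAut.conj g • H : Subgroup G) = Nat.card H :=
    (Nat.card_congr (equivSMul (MulAut.conj g) H).toEquiv).symm
  have h2 : (MulAut.conj g • H).index = H.index := by
    have := relIndex_pointwise_smul (MulAut.conj g) H ⊤
    rwa [relIndex_top_right, show MulAut.conj g • (⊤ : Subgroup G) = ⊤ from by
      ext; simp [mem_cj], relIndex_top_right] at this
  unfold IsHallSigmaI
  rwa [h1, h2]

theorem final_step {ι : Type*} {σ : ι → Set ℕ} {G : Type*} [Group G] [Finite G]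
    {A B K H₀ : Subgroup G} {i : ι} (hAB : A ≤ B) (hKB : K ≤ B)
    (hK1 : IsSigmaNumber σ i (Nat.card K))
    (hK2 : ∀ p : ℕ, p.Prime → p ∣ K.relIndex B → p ∉ σ i)
    (hA : ∀ H : Subgroup G, IsHallSigmaI σ i H → Perm A H) (hH₀ : IsHallSigmaI σ i H₀)
    (hP : PP σ A) : Perm A K := by
  let D : Subgroup G := closure {x | x ∈ A ∧ ∀ p : ℕ, p.Prime → p ∣ orderOf x → p ∉ σ i}
  have hDA : D ≤ A := (closure_le _).2 fun x hx => hx.1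
  have hmemD : ∀ x ∈ A, (∀ p : ℕ, p.Prime → p ∣ orderOf x → p ∉ σ i) → x ∈ D :=
    fun x h1 h2 => subset_closure ⟨h1, h2⟩
  have hAL : ∀ H : Subgroup G, IsHallSigmaI σ i H → IsSigmaNumber σ i (A.relIndex (A ⊔ H)) := by
    intro H hH q hq hd
    rw [(hA H hH).relIndex] at hd
    exact hH.1 q hq (hd.trans (relIndex_dvd_card _ _))
  -- Hall subgroups normalize `D`
  have hDH : ∀ H : Subgroup G, IsHallSigmaI σ i H → ∀ b ∈ H, ∀ d ∈ D, b * d * b⁻¹ ∈ D := by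
    intro H hH b hb d hd
    have hle : D ≤ D.comap (MulAut.conj b).toMonoidHom := by
      refine (closure_le _).2 fun x hx => ?_
      have ho : orderOf (b * x * b⁻¹) = orderOf x := by
        have := orderOf_injective (MulAut.conj b).toMonoidHom (MulAut.conj b).injective x
        simpa using this
      have hmem : b * x * b⁻¹ ∈ A := by
        refine hP i (A ⊔ H) (hAL H hH) _ ?_ (by rw [ho]; exact hx.2)
        exact mul_mem (mul_mem (mem_sup_right hb) (mem_sup_left hx.1))
          (inv_mem (mem_sup_right hb))
      have := hmemD _ hmem (by rw [ho]; exact hx.2)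
      simpa using this
    simpa using hle hd
  have hKD : K ≤ normalizer (D : Set G) := by
    refine le_trans ?_ (nc_le (H := H₀) fun x b hb a ha => hDH _ (hall_conj hH₀ x) b hb a ha)
    intro k hk
    apply mem_of_coprime
    intro p hp h1 h2
    refine hH₀.2 p hp (h2.trans (index_dvd_of_le subset_normalClosure)) (hK1 p hp (h1.trans ?_))
    have := orderOf_dvd_natCard (⟨k, hk⟩ : K)
    rwa [Subgroup.orderOf_mk] at this
  have hDAi : IsSigmaNumber σ i (D.relIndex A) := by
    intro q hq hd
    by_contra hqi
    haveI : Fact q.Prime := ⟨hq⟩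
    obtain ⟨P⟩ := (inferInstance : Nonempty (Sylow q A))
    have hle : (P : Subgroup A) ≤ D.subgroupOf A := by
      intro x hx
      rw [mem_subgroupOf]
      refine hmemD _ x.2 fun p hp hpo => ?_
      rw [Subgroup.orderOf_coe] at hpo
      obtain ⟨k, hk⟩ := P.2 ⟨x, hx⟩
      have hk' : x ^ q ^ k = 1 := by simpa [Subtype.ext_iff] using hk
      have := (Nat.prime_dvd_prime_iff_eq hp hq).1
        (hp.dvd_of_dvd_pow (hpo.trans (orderOf_dvd_of_pow_eq_one hk')))
      rwa [this]
    exact P.not_dvd_index (hd.trans (index_dvd_of_le hle))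
  have hADH : ∀ H : Subgroup G, IsHallSigmaI σ i H → A ≤ D ⊔ H := by
    intro H hH
    refine le_trans (le_sup_left : A ≤ A ⊔ H) (le_of_relIndex ?_)
    intro q hq hd
    refine hH.2 q hq ?_ ?_
    · exact (hd.trans (relIndex_dvd_of_le_left _ le_sup_right)).trans
        (relIndex_dvd_index_of_le le_sup_right)
    · have h1 := hd.trans (relIndex_dvd_of_le_left (A ⊔ H) (le_sup_left : D ≤ D ⊔ H))
      rw [← relIndex_mul_relIndex D A (A ⊔ H) hDA le_sup_left] at h1
      rcases (Nat.Prime.dvd_mul hq).1 h1 with h | h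
      · exact hDAi q hq h
      · exact hAL H hH q hq h
  have hpDH : ∀ H : Subgroup G, IsHallSigmaI σ i H → Perm D H := fun H hH =>
    perm_of_le_normalizer (hDH H hH)
  let E : Subgroup G := ⨅ H : {H : Subgroup G // IsHallSigmaI σ i H}, D ⊔ H.1
  have hAE : A ≤ E := le_iInf fun H => hADH H.1 H.2
  have hEK : ∀ k ∈ K, ∀ y ∈ E, k * y * k⁻¹ ∈ E := by
    intro k hk y hy
    rw [mem_iInf] at hy ⊢
    rintro ⟨H, hH⟩
    have h1 := hy ⟨_, hall_conj hH k⁻¹⟩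
    obtain ⟨d, hd, h, hh, rfl⟩ := (hpDH _ (hall_conj hH k⁻¹)).mem_sup h1
    have hd' : k * d * k⁻¹ ∈ D := (mem_normalizer_iff.1 (hKD hk) d).1 hd
    have hh' : k * h * k⁻¹ ∈ H := by
      rw [mem_cj] at hh; simpa using hh
    have := mul_mem (mem_sup_left hd' : _ ∈ D ⊔ H) (mem_sup_right hh')
    simpa [mul_assoc] using this
  have hEBK : Perm (E ⊓ B) K := perm_of_le_normalizer fun b hb a ha =>
    mem_inf.2 ⟨hEK b hb a ha.1, mul_mem (mul_mem (hKB hb) ha.2) (inv_mem (hKB hb))⟩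
  have hDEB : D ≤ E ⊓ B := le_inf (hDA.trans hAE) (hDA.trans hAB)
  have hF : (E ⊓ B) ⊔ K ≤ D ⊔ K := by
    apply le_of_relIndex
    intro q hq hd
    refine hK2 q hq ?_ ?_
    · have h1 := hd.trans (relIndex_dvd_of_le_left _ (le_sup_right : K ≤ D ⊔ K))
      rw [← relIndex_mul_relIndex K (E ⊓ B ⊔ K) B le_sup_right (sup_le inf_le_right hKB)]
      exact h1.mul_right _
    · have h1 := hd.trans (relIndex_dvd_of_le_left (E ⊓ B ⊔ K) (le_sup_left : D ≤ D ⊔ K))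
      rw [← relIndex_mul_relIndex D (E ⊓ B) (E ⊓ B ⊔ K) hDEB le_sup_left] at h1
      rcases (Nat.Prime.dvd_mul hq).1 h1 with h | h
      · refine hH₀.1 q hq (dvd_trans ?_ (relIndex_dvd_card D H₀))
        rw [← (hpDH H₀ hH₀).relIndex, ← relIndex_mul_relIndex D (E ⊓ B) (D ⊔ H₀) hDEB
          (inf_le_left.trans (iInf_le _ (⟨H₀, hH₀⟩ : {H : Subgroup G // IsHallSigmaI σ i H})))]
        exact h.mul_right _
      · rw [hEBK.relIndex] at h
        exact hK1 q hq (h.trans (relIndex_dvd_card _ _))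
  have hADK : A ≤ D ⊔ K := (le_inf hAE hAB).trans (le_sup_left.trans hF)
  have hpDK : Perm D K := perm_of_le_normalizer fun b hb a ha =>
    (mem_normalizer_iff.1 (hKD hb) a).1 ha
  intro a ha b hb
  have hab : a * b ∈ K ⊔ D := by
    rw [sup_comm]; exact mul_mem (hADK ha) (mem_sup_right hb)
  obtain ⟨k, hk, d, hd, e⟩ := hpDK.symm.mem_sup hab
  exact ⟨k, hk, d, hDA hd, e⟩

/-- If `A` is σ-permutable in the σ-full finite group `G`, `B` is σ-subnormal in `G`
and `A ≤ B`, then `A` is σ-permutable in `B`. -/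
theorem statement_10 {ι : Type*} (σ : ι → Set ℕ) (hσ : IsPrimePartition σ)
    {G : Type*} [Group G] [Finite G] (hfull : IsSigmaFull σ G)
    (A B : Subgroup G) (hAB : A ≤ B)
    (hA : IsSigmaPermutable σ A) (hB : IsSigmaSubnormal σ B) :
    IsSigmaPermutable σ (A.subgroupOf B) := by
  have hall : ∀ i, ∃ H : Subgroup G, IsHallSigmaI σ i H := by
    intro i
    by_cases h : ∃ p : ℕ, p.Prime ∧ p ∈ σ i ∧ p ∣ Nat.card G
    · exact hfull i h
    · refine ⟨⊥, ?_, ?_⟩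
      · intro p hp hd
        rw [card_bot, Nat.dvd_one] at hd
        exact absurd hd hp.ne_one
      · intro p hp hd hpi
        rw [index_bot] at hd
        exact h ⟨p, hp, hpi, hd⟩
  choose H hH using hall
  have hW : WW σ A H := ⟨hH, fun i x => perm_iff.1 (hA i _ (hall_conj (hH i) x))⟩
  have hP : PP σ A := WW.main σ hσ _ _ A H le_rfl le_rfl hW
  intro i K hK
  have hcard : Nat.card (K.map B.subtype) = Nat.card K :=
    card_map_of_injective B.subtype_injective
  have hKB : K.map B.subtype ≤ B := map_subtype_le K
  have hidx : (K.map B.subtype).relIndex B = K.index := by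
    rw [relIndex, subgroupOf, comap_map_eq_self_of_injective B.subtype_injective]
  have key : Perm A (K.map B.subtype) := final_step hAB hKB (by rw [hcard]; exact hK.1)
    (by rw [hidx]; exact hK.2) (fun L hL => perm_iff.1 (hA i L hL)) (hH i) hP
  rw [perm_iff]
  intro a ha b hb
  obtain ⟨b', ⟨b₁, hb₁, hb₂⟩, a', ha', e⟩ := key a ha b ⟨b, hb, rfl⟩
  refine ⟨b₁, hb₁, ⟨a', hAB ha'⟩, ha', ?_⟩
  ext
  rw [← hb₂] at e
  exact e
end

section
/- Let σ be a partition of the primes and suppose the finite group G is a direct product G = U₁ × ⋯ × U_k of non-abelian simple groups. Then every submodular subgroup of G is normal in G. -/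
open Subgroup
open scoped Pointwise

section Helpers

open scoped commutatorElement

theorem iSup_normal_aux {G : Type*} [Group G] {ι : Sort*} {V : ι → Subgroup G}
    (hV : ∀ i, (V i).Normal) : (⨆ i, V i).Normal := by
  constructor
  intro x hx g
  have h : (⨆ i, V i).map (MulAut.conj g).toMonoidHom ≤ ⨆ i, V i := by
    rw [Subgroup.map_iSup]
    refine iSup_le fun i => le_iSup_of_le i ?_
    rintro _ ⟨y, hy, rfl⟩
    exact (hV i).conj_mem y hy g
  exact h ⟨x, hx, rfl⟩

theorem modular_sup {G : Type*} [Group G] {A B : Subgroup G} (hA : IsModularSubgroup A)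
    (hB : IsModularSubgroup B) : IsModularSubgroup (A ⊔ B) := by
  constructor
  · intro X Z hXZ
    apply le_antisymm
    · exact le_inf (sup_le_sup_left inf_le_left _) (sup_le hXZ inf_le_right)
    · have h1 := hB.1 (X ⊔ A) (A ⊔ Z) (sup_le (hXZ.trans le_sup_right) le_sup_left)
      have h2 := hA.2 B (A ⊔ Z) le_sup_left
      have h3 := hA.2 Z ((A ⊔ B) ⊓ (A ⊔ Z)) (le_inf le_sup_left le_sup_left)
      have h4 := hA.1 (X ⊔ (Z ⊓ ((A ⊔ B) ⊓ (A ⊔ Z)))) Z (sup_le hXZ inf_le_left)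
      have hW : (X ⊔ (A ⊔ B)) ⊓ Z ≤ ((X ⊔ A ⊔ B) ⊓ (A ⊔ Z)) ⊓ Z := by
        refine le_inf (le_inf ?_ (inf_le_right.trans le_sup_right)) inf_le_right
        rw [sup_assoc]; exact inf_le_left
      refine hW.trans ?_
      rw [← h1, sup_assoc, h2]
      have h5 : (A ⊔ B) ⊓ (A ⊔ Z) ≤ A ⊔ Z ⊓ ((A ⊔ B) ⊓ (A ⊔ Z)) := by
        rw [h3]; exact le_inf inf_le_right le_rfl
      have h6 : (X ⊔ (A ⊔ B) ⊓ (A ⊔ Z)) ⊓ Z ≤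
          (X ⊔ Z ⊓ ((A ⊔ B) ⊓ (A ⊔ Z)) ⊔ A) ⊓ Z := by
        refine inf_le_inf_right _ (sup_le ?_ ?_)
        · exact le_sup_left.trans le_sup_left
        · refine h5.trans (sup_le le_sup_right (le_sup_right.trans le_sup_left))
      refine h6.trans ?_
      rw [← h4]
      refine sup_le (sup_le le_sup_left ?_) ?_
      · exact le_sup_of_le_right (le_inf (inf_le_right.trans inf_le_left) inf_le_left)
      · exact le_sup_of_le_right (inf_le_inf_right _ le_sup_left)
  · intro Y Z hZ
    have h1 := hA.2 (B ⊔ Y) Z (le_sup_left.trans hZ)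
    have h2 := hB.2 Y Z (le_sup_right.trans hZ)
    rw [sup_assoc, sup_assoc, ← h1, ← h2]

theorem modular_map {G : Type*} [Group G] {M : Subgroup G} (hM : IsModularSubgroup M)
    (e : Subgroup G ≃o Subgroup G) : IsModularSubgroup (e M) := by
  constructor
  · intro X Z h
    have := congrArg e (hM.1 (e.symm X) (e.symm Z) (e.symm.monotone h))
    simpa using this
  · intro Y Z h
    have := congrArg e (hM.2 (e.symm Y) (e.symm Z) (by
      rw [OrderIso.le_symm_apply]; exact h))
    simpa using this

/-- index of a maximal subgroup of a finite p-group -/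
theorem index_of_coatom {P : Type*} [Group P] [Finite P] {p : ℕ} [hp : Fact p.Prime]
    (hP : IsPGroup p P) {H : Subgroup P} (hH : IsCoatom H) : H.index = p := by
  obtain ⟨n, hn⟩ := (hP.to_subgroup H).exists_card_eq
  obtain ⟨m, hm⟩ := hP.exists_card_eq
  have hlt : n < m := by
    by_contra hc
    apply hH.1
    apply Subgroup.eq_top_of_le_card
    rw [hn, hm]
    exact Nat.pow_le_pow_right hp.out.pos (not_lt.mp hc)
  obtain ⟨K, hK, hHK⟩ := Sylow.exists_subgroup_card_pow_succ
    (p := p) (n := n) (by rw [hm]; exact pow_dvd_pow p hlt) hn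
  have hKt : K = ⊤ := by
    apply hH.2
    refine lt_of_le_of_ne hHK ?_
    rintro rfl
    rw [hn] at hK
    have := Nat.pow_right_injective hp.out.two_le hK
    omega
  subst hKt
  have h1 := H.card_mul_index
  rw [Subgroup.card_top] at hK
  rw [hK, hn, pow_succ] at h1
  exact Nat.eq_of_mul_eq_mul_left (pow_pos hp.out.pos n) h1

theorem key_corefree {Q : Type*} [Group Q] [Finite Q] (N : Subgroup Q)
    (hN : N ≠ ⊤) (hperf : commutator Q = ⊤) (hcore : N.normalCore = ⊥)
    (hmax : ∀ Y T : Subgroup Q, N ⊓ Y ≤ T → T ≤ Y → ¬ T ≤ N → T = Y) : False := by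
  have hcard : Nat.card Q ≠ 1 := by
    intro h
    have := (Nat.card_eq_one_iff_unique.mp h).1
    exact hN (Subsingleton.elim _ _)
  obtain ⟨p, hpdef⟩ : ∃ p, p = (Nat.card Q).minFac := ⟨_, rfl⟩
  have hp : Fact p.Prime := ⟨hpdef ▸ Nat.minFac_prime hcard⟩
  have hpd : p ∣ Nat.card Q := hpdef ▸ Nat.minFac_dvd _
  -- main claim, for an arbitrary Sylow subgroup
  have claim : ∀ P : Subgroup Q, IsPGroup p P → ∀ a ∈ P, ∀ y ∈ normalizer (P : Set Q), ⁅a, y⁆ ∈ N := by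
    intro P hPp a ha y hy
    by_cases hPN : P ≤ N
    · apply hPN
      rw [commutatorElement_def, mul_assoc, mul_assoc]
      refine mul_mem ha ?_
      rw [← mul_assoc]
      exact (mem_normalizer_iff.mp hy _).mp (inv_mem ha)
    · set Y : Subgroup Q := normalizer (P : Set Q) with hY
      have hPY : P ≤ Y := le_normalizer
      have hco : IsCoatom (N.subgroupOf P) := by
        constructor
        · rw [Ne, subgroupOf_eq_top]; exact hPN
        · intro T hT
          have h1 : N ⊓ P ≤ T.map P.subtype := by
            rw [← subgroupOf_map_subtype]
            exact map_mono hT.le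
          have h2 := hmax P (T.map P.subtype) h1 (map_subtype_le T) (by
            intro h
            refine not_le_of_gt hT ?_
            intro t ht
            exact h (mem_map_of_mem _ ht))
          rw [eq_top_iff]
          intro t _
          have : (t : Q) ∈ T.map P.subtype := by rw [h2]; exact t.2
          obtain ⟨s, hs, hst⟩ := this
          rwa [← Subtype.ext (a1 := s) (a2 := t) hst]
      have hidx : N.relIndex P = p := index_of_coatom hPp hco
      have hsup : (N ⊓ Y) ⊔ P = Y := hmax Y _ le_sup_left (sup_le inf_le_right hPY)
        (fun h => hPN (le_sup_right.trans h))
      have hnorm : (P.subgroupOf Y).Normal := by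
        rw [hY]; exact normal_in_normalizer
      have hsup' : N.subgroupOf Y ⊔ P.subgroupOf Y = ⊤ := by
        rw [← inf_subgroupOf_right N Y, ← subgroupOf_sup inf_le_right hPY, hsup, subgroupOf_self]
      have hrel : (P.subgroupOf Y).relIndex (N.subgroupOf Y) =
          (P.subgroupOf Y).index := by
        rw [← relIndex_sup_right, hsup', relIndex_top_right]
      have e1 := relIndex_mul_index (H := N.subgroupOf Y ⊓ P.subgroupOf Y)
        (K := P.subgroupOf Y) inf_le_right
      have e2 := relIndex_mul_index (H := N.subgroupOf Y ⊓ P.subgroupOf Y)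
        (K := N.subgroupOf Y) inf_le_left
      rw [inf_relIndex_right] at e1
      rw [inf_relIndex_left, hrel] at e2
      have e3 : (N.subgroupOf Y).relIndex (P.subgroupOf Y) = p := by
        rw [relIndex_subgroupOf hPY, hidx]
      have e4 : (N.subgroupOf Y).index = p := by
        rw [← e1, e3, mul_comm] at e2
        exact Nat.eq_of_mul_eq_mul_right (Nat.pos_of_ne_zero index_ne_zero_of_finite) e2
      have hmf : (Nat.card Y).minFac = p := by
        have hd : p ∣ Nat.card Y := e4 ▸ index_dvd_card _
        apply le_antisymm (Nat.minFac_le_of_dvd hp.out.two_le hd)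
        rw [hpdef]
        refine Nat.minFac_le_of_dvd (Nat.minFac_prime ?_).two_le
          ((Nat.minFac_dvd _).trans (card_subgroup_dvd_card Y))
        intro h; rw [h] at hd
        exact hp.out.one_lt.ne' (Nat.dvd_one.mp hd)
      have hNn : (N.subgroupOf Y).Normal := normal_of_index_eq_minFac_card (e4.trans hmf.symm)
      have hcyc : IsCyclic (Y ⧸ N.subgroupOf Y) := isCyclic_of_prime_card (p := p) e4
      have hcle := Subgroup.Normal.quotient_commutative_iff_commutator_le.mp
        (⟨⟨fun a b => (IsCyclic.commGroup (α := Y ⧸ N.subgroupOf Y)).mul_comm a b⟩⟩ :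
          IsMulCommutative (Y ⧸ N.subgroupOf Y))
      have := hcle (commutator_mem_commutator (mem_top (⟨a, hPY ha⟩ : Y)) (mem_top (⟨y, hy⟩ : Y)))
      exact this
  obtain ⟨P⟩ : Nonempty (Sylow p Q) := inferInstance
  have hcent : normalizer (P : Set Q) ≤ centralizer (P : Set Q) := by
    intro y hy
    rw [mem_centralizer_iff]
    intro a ha
    rw [← commutatorElement_eq_one_iff_mul_comm, ← mem_bot, ← hcore]
    intro g
    have hy' : ∀ h : Q, h ∈ (P : Subgroup Q) ↔ y * h * y⁻¹ ∈ (P : Subgroup Q) :=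
      mem_normalizer_iff.mp hy
    have hconj : ∀ h : Q, h ∈ (P : Subgroup Q).map (MulAut.conj g).toMonoidHom ↔
        g⁻¹ * h * g ∈ (P : Subgroup Q) := by
      intro h
      constructor
      · rintro ⟨b, hb, rfl⟩
        have e : g⁻¹ * (MulAut.conj g).toMonoidHom b * g = b := by simp [mul_assoc]
        rw [e]; exact hb
      · intro hb
        exact ⟨_, hb, by simp [mul_assoc]⟩
    have := claim ((P : Subgroup Q).map (MulAut.conj g).toMonoidHom) (P.2.map _) (g * a * g⁻¹)
      ⟨a, ha, rfl⟩ (g * y * g⁻¹) (by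
        rw [mem_normalizer_iff]
        intro h
        rw [hconj, hconj, hy']
        simp [mul_assoc])
    rwa [← conjugate_commutatorElement] at this
  have hcomp := MonoidHom.ker_transferSylow_isComplement' P hcent
  have hker : (MonoidHom.transferSylow P hcent).ker = ⊤ := by
    rw [eq_top_iff, ← hperf, _root_.commutator_def, commutator_le]
    intro a _ b _
    rw [MonoidHom.mem_ker, map_commutatorElement, commutatorElement_eq_one_iff_mul_comm]
    exact Subtype.ext (hcent (le_normalizer (Subtype.coe_prop _)) _ (Subtype.coe_prop _))
  rw [hker] at hcomp
  have hb : (P : Subgroup Q) = ⊥ := by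
    simpa [disjoint_iff] using hcomp.disjoint
  exact P.ne_bot_of_dvd_card hpd hb

theorem key_general {Q : Type*} [Group Q] [Finite Q] (N : Subgroup Q)
    (hN : N ≠ ⊤) (hperf : commutator Q = ⊤)
    (hmax : ∀ Y T : Subgroup Q, N ⊓ Y ≤ T → T ≤ Y → ¬ T ≤ N → T = Y) : False := by
  set K := N.normalCore with hK
  let f := QuotientGroup.mk' K
  have hf : Function.Surjective f := QuotientGroup.mk'_surjective K
  have hKN : K ≤ N := N.normalCore_le
  have hcm : (N.map f).comap f = N := by
    rw [comap_map_eq, QuotientGroup.ker_mk', sup_eq_left.mpr hKN]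
  apply key_corefree (N.map f)
  · intro h
    rw [h, comap_top] at hcm
    exact hN hcm.symm
  · rw [_root_.commutator_def, ← map_top_of_surjective f hf, ← map_commutator, ← _root_.commutator_def, hperf]
  · rw [eq_bot_iff]
    intro x hx
    obtain ⟨x, rfl⟩ := hf x
    have : x ∈ K := by
      intro g
      have := hx (f g)
      rw [← hcm]
      simpa using this
    rw [mem_bot]
    exact (QuotientGroup.eq_one_iff x).mpr this
  · intro Y T h1 h2 h3
    apply comap_injective hf
    apply hmax
    · have h4 : comap f (N.map f ⊓ Y) ≤ comap f T := comap_mono h1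
      rw [comap_inf, hcm] at h4
      exact h4
    · exact comap_mono h2
    · intro h; apply h3
      rw [← map_comap_eq_self_of_surjective hf T]; exact map_mono h

theorem maximal_modular_normal {E : Type*} [Group E] [Finite E] (hperf : commutator E = ⊤)
    {M : Subgroup E} (hM : IsModularSubgroup M)
    (hmax : ∀ M' : Subgroup E, IsModularSubgroup M' → M ≤ M' → M' = M ∨ M' = ⊤) : M.Normal := by
  rw [← normalizer_eq_top_iff]
  by_contra hN
  refine key_general _ hN hperf ?_
  intro Y T h1 h2 h3
  have hTM : T ⊔ M = ⊤ := by
    obtain ⟨x, hxT, hxN⟩ := SetLike.not_le_iff_exists.mp h3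
    have hmod := modular_sup hM (modular_map hM (MulAut.conj x).mapSubgroup)
    rcases hmax _ hmod le_sup_left with h | h
    · exfalso
      apply hxN
      have hle : M.map (MulAut.conj x).toMonoidHom ≤ M := sup_eq_left.mp h
      have heq : M.map (MulAut.conj x).toMonoidHom = M := by
        apply Subgroup.eq_of_le_of_card_ge hle
        exact (card_mapSubgroup (MulAut.conj x) (H := M)).ge
      rw [mem_normalizer_iff]
      intro m
      constructor
      · intro hm
        exact hle ⟨m, hm, rfl⟩
      · intro hm
        rw [← heq] at hm
        obtain ⟨b, hb, hbm⟩ := hm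
        have : b = m := (MulAut.conj x).injective hbm
        rwa [← this]
    · rw [eq_top_iff, ← h]
      refine sup_le le_sup_right ?_
      rintro _ ⟨m, hm, rfl⟩
      have hx : x ∈ T ⊔ M := le_sup_left (a := T) hxT
      exact mul_mem (mul_mem hx (le_sup_right (a := T) hm)) (inv_mem hx)
  have := hM.1 T Y h2
  rw [hTM, top_inf_eq] at this
  rw [← this, left_eq_sup]
  exact (inf_le_inf_right _ le_normalizer).trans h1

/-- `M` is modular in `E`, expressed inside the big group. -/
def RelMod {G : Type*} [Group G] (E M : Subgroup G) : Prop :=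
  (∀ X Z : Subgroup G, Z ≤ E → X ≤ Z → X ⊔ (M ⊓ Z) = (X ⊔ M) ⊓ Z) ∧
  (∀ Y Z : Subgroup G, Y ≤ E → Z ≤ E → M ≤ Z → M ⊔ (Y ⊓ Z) = (M ⊔ Y) ⊓ Z)

theorem relMod_of_modular {G : Type*} [Group G] {E : Subgroup G} {M : Subgroup E}
    (hM : IsModularSubgroup M) : RelMod E (M.map E.subtype) := by
  have hi := E.subtype_injective
  have hr : ∀ X : Subgroup G, X ≤ E → (X.subgroupOf E).map E.subtype = X := by
    intro X hX
    rw [subgroupOf_map_subtype, inf_eq_left.mpr hX]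
  constructor
  · intro X Z hZ hXZ
    have := congrArg (Subgroup.map E.subtype)
      (hM.1 (X.subgroupOf E) (Z.subgroupOf E) (comap_mono hXZ))
    rwa [Subgroup.map_sup, map_inf _ _ _ hi, map_inf _ _ _ hi, Subgroup.map_sup, hr X (hXZ.trans hZ),
      hr Z hZ] at this
  · intro Y Z hY hZ hMZ
    have := congrArg (Subgroup.map E.subtype)
      (hM.2 (Y.subgroupOf E) (Z.subgroupOf E) (map_le_iff_le_comap.mp hMZ))
    rwa [Subgroup.map_sup, map_inf _ _ _ hi, map_inf _ _ _ hi, Subgroup.map_sup, hr Y hY,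
      hr Z hZ] at this

theorem modular_of_relMod {G : Type*} [Group G] {E M : Subgroup G} (hME : M ≤ E)
    (hM : RelMod E M) : IsModularSubgroup (M.subgroupOf E) := by
  have hi := E.subtype_injective
  have hr : (M.subgroupOf E).map E.subtype = M := by
    rw [subgroupOf_map_subtype, inf_eq_left.mpr hME]
  constructor
  · intro X Z hXZ
    apply map_injective hi
    rw [Subgroup.map_sup, map_inf _ _ _ hi, map_inf _ _ _ hi, Subgroup.map_sup, hr]
    exact hM.1 _ _ (map_subtype_le Z) (map_mono hXZ)
  · intro Y Z hMZ
    apply map_injective hi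
    rw [Subgroup.map_sup, map_inf _ _ _ hi, map_inf _ _ _ hi, Subgroup.map_sup, hr]
    refine hM.2 _ _ (map_subtype_le Y) (map_subtype_le Z) ?_
    rw [← hr]; exact map_mono hMZ

section Products

variable {G : Type*} [Group G] {k : ℕ} {U : Fin k → Subgroup G}

theorem center_trivial (hcomm : ∀ i j, i ≠ j → ∀ a ∈ U i, ∀ b ∈ U j, a * b = b * a)
    (hnorm : ∀ i, (U i).Normal)
    (hcen : ∀ i, ∀ u ∈ U i, (∀ a ∈ U i, u * a = a * u) → u = 1)
    (L : Finset (Fin k)) : ∀ b ∈ (⨆ i ∈ L, U i), (∀ i ∈ L, ∀ a ∈ U i, b * a = a * b) → b = 1 := by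
  classical
  induction L using Finset.induction_on with
  | empty => intro b hb _; simpa using hb
  | insert i L hi ih =>
    intro b hb hc
    rw [Finset.iSup_insert] at hb
    have := hnorm i
    obtain ⟨u, hu, v, hv, rfl⟩ := mem_sup_of_normal_left.mp hb
    have hvc : (⨆ j ∈ L, U j) ≤ centralizer (U i : Set G) := by
      refine iSup₂_le fun j hj b hb => ?_
      rw [mem_centralizer_iff]
      intro a ha
      exact hcomm i j (by rintro rfl; exact hi hj) a ha b hb
    have hu1 : u = 1 := by
      apply hcen i u hu
      intro a ha
      have h1 := hc i (Finset.mem_insert_self _ _) a ha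
      have h2 := mem_centralizer_iff.mp (hvc hv) a ha
      apply mul_right_cancel (b := v)
      rw [mul_assoc, h2, ← mul_assoc, h1, mul_assoc]
    subst hu1
    rw [one_mul] at hc ⊢
    exact ih v hv fun j hj => hc j (Finset.mem_insert_of_mem hj)

theorem normal_in_good (hcomm : ∀ i j, i ≠ j → ∀ a ∈ U i, ∀ b ∈ U j, a * b = b * a)
    (hnorm : ∀ i, (U i).Normal)
    (hcen : ∀ i, ∀ u ∈ U i, (∀ a ∈ U i, u * a = a * u) → u = 1)
    (hsimple : ∀ i, IsSimpleGroup ↥(U i))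
    (I : Finset (Fin k)) (S : Subgroup G) (hS : S ≤ ⨆ i ∈ I, U i)
    (hSn : (S.subgroupOf (⨆ i ∈ I, U i)).Normal) : ∃ J : Finset (Fin k), S = ⨆ i ∈ J, U i := by
  classical
  have hconj : ∀ s ∈ S, ∀ e ∈ (⨆ i ∈ I, U i), e * s * e⁻¹ ∈ S := by
    intro s hs e he
    exact hSn.conj_mem ⟨s, hS hs⟩ hs ⟨e, he⟩
  have hUI : ∀ i ∈ I, U i ≤ ⨆ i ∈ I, U i := fun i hi => le_iSup₂_of_le i hi le_rfl
  have hdis : ∀ i ∈ I, ¬ U i ≤ S → ∀ s ∈ S, ∀ a ∈ U i, s * a = a * s := by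
    intro i hi hn s hs a ha
    have hN : (S.subgroupOf (U i)).Normal := by
      constructor
      intro x hx g
      exact hconj x hx g (hUI i hi g.2)
    have hb : S.subgroupOf (U i) = ⊥ := by
      rcases (hsimple i).eq_bot_or_eq_top_of_normal _ hN with h | h
      · exact h
      · exact absurd (subgroupOf_eq_top.mp h) hn
    have hmem : ⁅s, a⁆ ∈ U i := by
      rw [commutatorElement_def]
      exact mul_mem ((hnorm i).conj_mem a ha s) (inv_mem ha)
    have hmS : ⁅s, a⁆ ∈ S := by
      rw [commutatorElement_def, mul_assoc, mul_assoc]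
      refine mul_mem hs ?_
      rw [← mul_assoc]
      exact hconj _ (inv_mem hs) a (hUI i hi ha)
    have : (⟨⁅s, a⁆, hmem⟩ : U i) ∈ S.subgroupOf (U i) := hmS
    rw [hb, mem_bot] at this
    exact commutatorElement_eq_one_iff_mul_comm.mp (congrArg Subtype.val this)
  refine ⟨I.filter (fun i => U i ≤ S), ?_⟩
  have hle : (⨆ i ∈ I.filter (fun i => U i ≤ S), U i) ≤ S :=
    iSup₂_le fun i hi => (Finset.mem_filter.mp hi).2
  apply le_antisymm _ hle
  intro s hs
  have hn1 : (⨆ i ∈ I.filter (fun i => U i ≤ S), U i).Normal :=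
    iSup_normal_aux fun i => iSup_normal_aux fun _ => hnorm i
  have hs2 : s ∈ (⨆ i ∈ I.filter (fun i => U i ≤ S), U i) ⊔
      (⨆ i ∈ I.filter (fun i => ¬ U i ≤ S), U i) := by
    rw [← Finset.iSup_union, Finset.filter_union_filter_not_eq]
    exact hS hs
  obtain ⟨a, ha, b, hb, rfl⟩ := mem_sup_of_normal_left.mp hs2
  have hbS : b ∈ S := (mul_mem_cancel_left (hle ha)).mp hs
  have hb1 := center_trivial hcomm hnorm hcen _ b hb (fun i hi x hx => by
    rw [Finset.mem_filter] at hi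
    exact hdis i hi.1 hi.2 b hbS x hx)
  rw [hb1, mul_one]; exact ha

theorem modular_good [Finite G]
    (hcomm : ∀ i j, i ≠ j → ∀ a ∈ U i, ∀ b ∈ U j, a * b = b * a)
    (hnorm : ∀ i, (U i).Normal)
    (hcen : ∀ i, ∀ u ∈ U i, (∀ a ∈ U i, u * a = a * u) → u = 1)
    (hsimple : ∀ i, IsSimpleGroup ↥(U i))
    (hperf : ∀ i, ⁅U i, U i⁆ = U i) (n : ℕ) :
    ∀ E M : Subgroup G, Nat.card E ≤ n → (∃ I : Finset (Fin k), E = ⨆ i ∈ I, U i) →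
      M ≤ E → RelMod E M → ∃ J : Finset (Fin k), M = ⨆ i ∈ J, U i := by
  induction n with
  | zero => intro E M h; exact absurd Nat.card_pos (not_lt.mpr h)
  | succ n ih =>
    intro E M hn hE hME hM
    by_cases hne : M = E
    · rwa [hne]
    obtain ⟨M1, hMM1, hmax⟩ := Set.Finite.exists_le_maximal
      (s := {T : Subgroup G | T < E ∧ RelMod E T}) (Set.toFinite _)
      (show M ∈ _ from ⟨lt_of_le_of_ne hME hne, hM⟩)
    obtain ⟨hM1E, hM1⟩ := hmax.prop
    have hEperf : commutator E = ⊤ := by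
      apply map_injective E.subtype_injective
      rw [_root_.commutator_def, map_commutator, ← MonoidHom.range_eq_map, range_subtype]
      apply le_antisymm (commutator_le_self _)
      obtain ⟨I, rfl⟩ := hE
      refine iSup₂_le fun i hi => ?_
      rw [← hperf i]
      have : U i ≤ ⨆ i ∈ I, U i := le_iSup₂_of_le i hi le_rfl
      exact commutator_mono this this
    have hnor : (M1.subgroupOf E).Normal := by
      apply maximal_modular_normal hEperf (modular_of_relMod hM1E.le hM1)
      intro M' hM' hle
      by_cases ht : M' = ⊤
      · exact Or.inr ht
      left
      have h1 : M1 ≤ M'.map E.subtype := by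
        have := map_mono (f := E.subtype) hle
        rwa [subgroupOf_map_subtype, inf_eq_left.mpr hM1E.le] at this
      have h2 : M'.map E.subtype < E := by
        refine lt_of_le_of_ne (map_subtype_le _) fun h => ht ?_
        apply map_injective E.subtype_injective
        rw [h, ← MonoidHom.range_eq_map, range_subtype]
      have h3 := hmax.le_of_ge ⟨h2, relMod_of_modular hM'⟩ h1
      apply le_antisymm _ hle
      exact map_le_iff_le_comap.mp h3
    have hM1g : ∃ J : Finset (Fin k), M1 = ⨆ i ∈ J, U i := by
      obtain ⟨I, rfl⟩ := hE
      exact normal_in_good hcomm hnorm hcen hsimple I M1 hM1E.le hnor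
    have hlt : Nat.card M1 < Nat.card E := by
      by_contra hc
      exact hM1E.ne (Subgroup.eq_of_le_of_card_ge hM1E.le (not_lt.mp hc))
    refine ih M1 M (by omega) hM1g hMM1 ⟨?_, ?_⟩
    · intro X Z hZ; exact hM.1 X Z (hZ.trans hM1E.le)
    · intro Y Z hY hZ; exact hM.2 Y Z (hY.trans hM1E.le) (hZ.trans hM1E.le)

end Products

end Helpers



/-- If the finite group `G` is the (internal) direct product of non-abelian simple
subgroups `U 1, ..., U k`, then every submodular subgroup of `G` is normal. -/
theorem statement_14 {G : Type*} [Group G] [Finite G] (k : ℕ)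
    (U : Fin k → Subgroup G)
    (hnorm : ∀ i, (U i).Normal)
    (hsimple : ∀ i, IsSimpleGroup ↥(U i))
    (hnonab : ∀ i, ¬ ∀ a ∈ U i, ∀ b ∈ U i, a * b = b * a)
    (hind : iSupIndep U) (hsup : iSup U = ⊤)
    (A : Subgroup G) (hA : IsSubmodular A) :
    A.Normal := by
  have hcomm : ∀ i j, i ≠ j → ∀ a ∈ U i, ∀ b ∈ U j, a * b = b * a := by
    intro i j hij a ha b hb
    exact commute_of_normal_of_disjoint (U i) (U j) (hnorm i) (hnorm j)
      (hind.pairwiseDisjoint hij) a b ha hb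
  have hcen : ∀ i, ∀ u ∈ U i, (∀ a ∈ U i, u * a = a * u) → u = 1 := by
    intro i u hu h
    have hc : (⟨u, hu⟩ : U i) ∈ center (U i) := by
      rw [mem_center_iff]
      intro g
      exact Subtype.ext (h g g.2).symm
    rcases (hsimple i).eq_bot_or_eq_top_of_normal (center (U i)) inferInstance with h1 | h1
    · rw [h1, mem_bot] at hc
      exact congrArg Subtype.val hc
    · exfalso
      apply hnonab i
      intro a ha b hb
      have : (⟨b, hb⟩ : U i) ∈ center (U i) := by rw [h1]; exact mem_top _
      exact congrArg Subtype.val (mem_center_iff.mp this ⟨a, ha⟩)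
  have hperf : ∀ i, ⁅U i, U i⁆ = U i := by
    intro i
    have h0 : (commutator (U i)).map (U i).subtype = ⁅U i, U i⁆ := by
      rw [_root_.commutator_def, map_commutator, ← MonoidHom.range_eq_map, range_subtype]
    rcases (hsimple i).eq_bot_or_eq_top_of_normal (commutator (U i)) inferInstance with h1 | h1
    · exfalso
      apply hnonab i
      intro a ha b hb
      rw [h1, Subgroup.map_bot] at h0
      have := commutator_mem_commutator ha hb
      rw [← h0, mem_bot] at this
      exact commutatorElement_eq_one_iff_mul_comm.mp this
    · rw [h1, ← MonoidHom.range_eq_map, range_subtype] at h0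
      exact h0.symm
  obtain ⟨n, C, h0, hl, hstep⟩ := hA
  have key : ∀ m : Fin (n + 1), ∃ J : Finset (Fin k), C m = ⨆ i ∈ J, U i := by
    intro m
    induction m using Fin.reverseInduction with
    | last => exact ⟨Finset.univ, by rw [hl, ← hsup]; simp⟩
    | cast m ih =>
      obtain ⟨hle, hmod⟩ := hstep m
      have hr := relMod_of_modular hmod
      rw [subgroupOf_map_subtype, inf_eq_left.mpr hle] at hr
      exact modular_good hcomm hnorm hcen hsimple hperf _ _ _ le_rfl ih hle hr
  obtain ⟨J, hJ⟩ := key 0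
  rw [← h0, hJ]
  exact iSup_normal_aux fun i => iSup_normal_aux fun _ => hnorm i
end
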